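/- arXiv:math/0411525 — 5 statements merged into one kernel-verified Lean document; each statement's English description precedes it below -/
import Mathlib

section
/- Let W = (W_1, …, W_d) and W' = (W'_1, …, W'_d) be ℕ^d-valued random vectors defined on a common probability space such that (W, W') is exchangeable (the joint law of (W, W') equals that of (W', W)), with E(W_k) = λ_k ∈ (0, ∞) for each k. Let Z = (Z_1, …, Z_d) have independent coordinates with Z_k Poisson-distributed with mean λ_k. For each k set A_k = {W'_k = W_k + 1 and W'_j = W_j for all k+1 ≤ j ≤ d} and B_k = {W'_k = W_k - 1 and W'_j = W_j for all k+1 ≤ j ≤ d}. Then for every h : ℕ^d → [0,1] and every choice of real constants c_1, …, c_d: |E h(W) - E h(Z)| ≤ Σ_{k=1}^d α_k · [ E|λ_k - c_k ℙ(A_k | W)| + E|W_k - c_k ℙ(B_k | W)| ], where α_k = min(1, 1.4 λ_k^{-1/2}) and ℙ(· | W) denotes conditional probability given the σ-field generated by W. -/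
open MeasureTheory

/-- The Poisson distribution on `ℕ` with mean `lam`, assigning mass
`e^{-λ} λ^k / k!` to each `k : ℕ`. -/
noncomputable def poissonMeasure (lam : ℝ) : Measure ℕ :=
  Measure.sum fun k : ℕ =>
    (ENNReal.ofReal (Real.exp (-lam) * lam ^ k / (Nat.factorial k))) • Measure.dirac k

open scoped ENNReal

lemma esplit (v : ℕ → ℝ≥0∞) (k : ℕ) :
    ∑' i, v i = ∑ i ∈ Finset.range k, v i + ∑' i, v (i + k) :=
  (Summable.sum_add_tsum_nat_add' (f := v) (k := k) ENNReal.summable).symm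

lemma lc_moment (w : ℕ → ℝ≥0∞)
    (hw : ∀ i l a, i ≤ l → w i * w (a + l) ≤ w (a + i) * w l) :
    (∑' i, w i) * (∑' i : ℕ, ((i * (i - 1) : ℕ) : ℝ≥0∞) * w i) ≤
      2 * (∑' i : ℕ, (i : ℝ≥0∞) * w i) ^ 2 := by
  set T : ℕ → ℝ≥0∞ := fun a => ∑' i, w (i + a) with hT
  have hsplit : ∀ a b, T a = ∑ i ∈ Finset.range b, w (a + i) + T (a + b) := by
    intro a b
    simp only [hT]
    rw [esplit (fun i => w (i + a)) b]
    congr 1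
    · exact Finset.sum_congr rfl fun i _ => by rw [add_comm]
    · congr 1; ext i; congr 1; ring
  have hTT : ∀ a b, T 0 * T (a + b) ≤ T a * T b := by
    intro a b
    rw [hsplit 0 b, hsplit a b, zero_add, add_mul, add_mul, mul_comm (T (a+b)) (T b)]
    gcongr ?_ + _
    rw [Finset.sum_mul, Finset.sum_mul]
    apply Finset.sum_le_sum
    intro i hi
    simp only [hT]
    rw [← ENNReal.tsum_mul_left, ← ENNReal.tsum_mul_left]
    apply ENNReal.tsum_le_tsum
    intro l
    have := hw i (l + b) a (by have := Finset.mem_range.1 hi; omega)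
    rw [zero_add]
    convert this using 3; ring
  -- layer cake
  have hcake : ∀ (v : ℕ → ℝ≥0∞) , ∑' i : ℕ, (i : ℝ≥0∞) * v i = ∑' a, ∑' i, v (i + (a + 1)) := by
    intro v
    have h1 : ∀ i : ℕ, (i : ℝ≥0∞) * v i = ∑' a : ℕ, if a < i then v i else 0 := by
      intro i
      rw [tsum_eq_sum (s := Finset.range i)]
      · rw [Finset.sum_congr rfl (g := fun _ => v i)]
        · simp
        · intro x hx; simp [Finset.mem_range.1 hx]
      · intro x hx; simp at hx; simp [hx]
    simp_rw [h1]
    rw [ENNReal.tsum_comm]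
    congr 1; ext a
    rw [esplit (fun i => if a < i then v i else 0) (a+1)]
    rw [Finset.sum_eq_zero]
    · rw [zero_add]; congr 1; ext i; rw [if_pos (by omega)]
    · intro x hx; have := Finset.mem_range.1 hx; rw [if_neg (by omega)]
  have hS1 : ∑' i : ℕ, (i : ℝ≥0∞) * w i = ∑' a, T (a + 1) := hcake w
  have hS2 : ∑' i : ℕ, ((i * (i - 1) : ℕ) : ℝ≥0∞) * w i = 2 * ∑' a, ∑' b, T ((a + 1) + (b + 1)) := by
    have e1 : ∑' a, ∑' b, T ((a + 1) + (b + 1)) = ∑' a : ℕ, (a : ℝ≥0∞) * T (a+1) := by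
      rw [hcake]; congr 1; ext a; congr 1; ext b; congr 1; ring
    have e2 : ∑' a : ℕ, (a : ℝ≥0∞) * T (a+1) =
        ∑' i : ℕ, ∑' a : ℕ, if a < i then (a : ℝ≥0∞) * w i else 0 := by
      rw [ENNReal.tsum_comm]
      congr 1; ext a
      rw [esplit (fun i => if a < i then (a : ℝ≥0∞) * w i else 0) (a+1)]
      rw [Finset.sum_eq_zero]
      · rw [zero_add, hT, ← ENNReal.tsum_mul_left]; congr 1; ext i; rw [if_pos (by omega)]
      · intro x hx; have := Finset.mem_range.1 hx; rw [if_neg (by omega)]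
    rw [e1, e2, ← ENNReal.tsum_mul_left]
    congr 1; ext i
    rw [tsum_eq_sum (s := Finset.range i)]
    · rw [Finset.sum_congr rfl (g := fun a : ℕ => (a:ℝ≥0∞) * w i)]
      · rw [← Finset.sum_mul, ← Finset.sum_range_id_mul_two, ← Nat.cast_sum]
        push_cast; ring
      · intro x hx; simp [Finset.mem_range.1 hx]
    · intro x hx; simp at hx; simp [hx]
  have hT0 : ∑' i, w i = T 0 := by simp [hT]
  rw [hS1, hS2, hT0, mul_left_comm, sq]
  gcongr 2 * ?_
  rw [← ENNReal.tsum_mul_left, ← ENNReal.tsum_mul_right]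
  apply ENNReal.tsum_le_tsum
  intro a
  rw [← ENNReal.tsum_mul_left, ← ENNReal.tsum_mul_left]
  exact ENNReal.tsum_le_tsum fun b => hTT _ _

lemma final_alg (l x y t : ℝ) (hx : 0 < x) (hy : 0 < y)
    (ha : 1 ≤ x - t) (hb : 0 ≤ y + t)
    (h1 : l ≤ (x - t) * (2 * x - t - 1)) (h2 : l ≤ (y + t) * (2 * y + t + 1)) :
    l ≤ 1.96 * (x + y) ^ 2 := by
  obtain ⟨s, hs⟩ : ∃ s, s = x + y := ⟨_, rfl⟩
  by_contra hc
  push Not at hc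
  rcases le_total 0 t with ht | ht
  · have : y + t ≤ 0.02 * (x + y) := by
      by_contra h; push Not at h
      nlinarith
    nlinarith
  · have : x - t ≤ 0.02 * (x + y) := by
      by_contra h; push Not at h
      nlinarith
    nlinarith

noncomputable def pw (l : ℝ) (m : ℕ) : ℝ := Real.exp (-l) * l ^ m / (Nat.factorial m)

lemma pw_pos {l : ℝ} (hl : 0 < l) (m : ℕ) : 0 < pw l m := by unfold pw; positivity

lemma pw_succ (l : ℝ) (m : ℕ) : ((m : ℝ) + 1) * pw l (m + 1) = l * pw l m := by
  unfold pw
  rw [Nat.factorial_succ]; push_cast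
  have : (m : ℝ) + 1 ≠ 0 := by positivity
  field_simp
  ring

lemma fact_lc (i k a : ℕ) (h : i ≤ k) :
    (a + i).factorial * k.factorial ≤ i.factorial * (a + k).factorial := by
  induction a with
  | zero => simp
  | succ a ih =>
    rw [show a + 1 + i = (a + i) + 1 by ring, show a + 1 + k = (a + k) + 1 by ring,
      Nat.factorial_succ, Nat.factorial_succ]
    calc (a + i + 1) * (a + i).factorial * k.factorial
        = (a + i + 1) * ((a + i).factorial * k.factorial) := by ring
      _ ≤ (a + k + 1) * (i.factorial * (a + k).factorial) := by gcongr
      _ = _ := by ring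

lemma pw_lc {l : ℝ} (hl : 0 < l) (i k a : ℕ) (h : i ≤ k) :
    pw l i * pw l (a + k) ≤ pw l (a + i) * pw l k := by
  unfold pw
  have e1 : Real.exp (-l) * l ^ i / (Nat.factorial i) * (Real.exp (-l) * l ^ (a+k) / (Nat.factorial (a+k)))
    = Real.exp (-l) ^ 2 * l ^ (a + i + k) / ((i.factorial * (a + k).factorial : ℕ) : ℝ) := by
    push_cast; rw [div_mul_div_comm]; ring
  have e2 : Real.exp (-l) * l ^ (a+i) / (Nat.factorial (a+i)) * (Real.exp (-l) * l ^ k / (Nat.factorial k))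
    = Real.exp (-l) ^ 2 * l ^ (a + i + k) / (((a + i).factorial * k.factorial : ℕ) : ℝ) := by
    push_cast; rw [div_mul_div_comm]; ring
  rw [e1, e2]
  apply div_le_div_of_nonneg_left (by positivity)
  · exact_mod_cast Nat.mul_pos (Nat.factorial_pos _) (Nat.factorial_pos _)
  · exact_mod_cast fact_lc i k a h

lemma pw_hasSum (l : ℝ) : HasSum (pw l) 1 := by
  have h := (NormedSpace.expSeries_div_hasSum_exp (𝔸 := ℝ) l)
  rw [← Real.exp_eq_exp_ℝ] at h
  have := h.mul_left (Real.exp (-l))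
  rw [← Real.exp_add, neg_add_cancel, Real.exp_zero] at this
  have e : pw l = fun i => Real.exp (-l) * (l ^ i / (i.factorial : ℝ)) := by
    ext i; unfold pw; ring
  rw [e]; exact this

noncomputable def ew (l : ℝ) (m : ℕ) : ℝ≥0∞ := ENNReal.ofReal (pw l m)

lemma ew_lc {l : ℝ} (hl : 0 < l) (i k a : ℕ) (h : i ≤ k) :
    ew l i * ew l (a + k) ≤ ew l (a + i) * ew l k := by
  unfold ew
  rw [← ENNReal.ofReal_mul (pw_pos hl _).le, ← ENNReal.ofReal_mul (pw_pos hl _).le]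
  exact ENNReal.ofReal_le_ofReal (pw_lc hl i k a h)

lemma ew_succ {l : ℝ} (hl : 0 < l) (m : ℕ) :
    ((m + 1 : ℕ) : ℝ≥0∞) * ew l (m + 1) = ENNReal.ofReal l * ew l m := by
  unfold ew
  rw [← ENNReal.ofReal_natCast, ← ENNReal.ofReal_mul (by positivity), ← ENNReal.ofReal_mul hl.le]
  congr 1; push_cast; exact pw_succ l m

lemma ew_sum {l : ℝ} (hl : 0 < l) : ∑' m, ew l m = 1 := by
  unfold ew
  rw [← ENNReal.ofReal_tsum_of_nonneg (fun n => (pw_pos hl n).le) (pw_hasSum l).summable,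
    (pw_hasSum l).tsum_eq, ENNReal.ofReal_one]

lemma nat_ident (i : ℕ) : i * i = i * (i - 1) + i := by
  cases i with
  | zero => rfl
  | succ n => simp; ring

lemma upper_tail {l : ℝ} (hl : 0 < l) (j : ℕ) :
    ∃ Q R1 R2 : ℝ, 0 ≤ R1 ∧ (∑' i, ew l (i + (j + 1))) = ENNReal.ofReal Q ∧ 0 < Q ∧
      R1 + (j + 1) * Q = l * pw l j + l * Q ∧ R2 + (j + 2) * R1 = l * (R1 + Q) ∧
      Q * R2 ≤ 2 * R1 ^ 2 := by
  set w : ℕ → ℝ≥0∞ := fun i => ew l (i + (j + 1)) with hw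
  set S0 := ∑' i, w i with hS0
  set S1 := ∑' i : ℕ, (i : ℝ≥0∞) * w i with hS1
  set S2 := ∑' i : ℕ, ((i * (i - 1) : ℕ) : ℝ≥0∞) * w i with hS2
  have h0 : S0 ≠ ∞ := by
    have := esplit (ew l) (j + 1)
    rw [ew_sum hl] at this
    have h2 : S0 ≤ 1 := by rw [this]; exact le_add_self
    exact ne_top_of_le_ne_top ENNReal.one_ne_top h2
  have hrec : ∀ i, ((i + j + 1 : ℕ) : ℝ≥0∞) * w i = ENNReal.ofReal l * ew l (i + j) := by
    intro i; rw [← ew_succ hl]; rfl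
  have id1 : S1 + ((j + 1 : ℕ) : ℝ≥0∞) * S0 = ENNReal.ofReal l * ew l j + ENNReal.ofReal l * S0 := by
    rw [hS1, hS0, ← ENNReal.tsum_mul_left, ← ENNReal.tsum_add, ← mul_add]
    have : ew l j + ∑' i, w i = ∑' i, ew l (i + j) := by
      rw [esplit (fun i => ew l (i + j)) 1]; simp [hw, add_comm, add_left_comm]
    rw [this, ← ENNReal.tsum_mul_left]
    congr 1; ext i; rw [← hrec]; push_cast; ring
  have id2 : S2 + ((j + 2 : ℕ) : ℝ≥0∞) * S1 = ENNReal.ofReal l * (S1 + S0) := by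
    have : S1 + S0 = ∑' i : ℕ, (i : ℝ≥0∞) * ew l (i + j) := by
      rw [esplit (fun i => (i : ℝ≥0∞) * ew l (i + j)) 1, hS1, hS0, ← ENNReal.tsum_add]
      simp only [Finset.range_one, Finset.sum_singleton, Nat.cast_zero, zero_mul, zero_add]
      congr 1; ext i; simp only [hw]
      rw [show i + 1 + j = i + (j + 1) by ring]; push_cast; ring
    rw [this, hS2, hS1, ← ENNReal.tsum_mul_left, ← ENNReal.tsum_mul_left, ← ENNReal.tsum_add]
    congr 1; ext i
    rw [mul_left_comm (ENNReal.ofReal l), ← hrec, ← mul_assoc, ← mul_assoc, ← add_mul, ← Nat.cast_mul, ← Nat.cast_mul, ← Nat.cast_add]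
    congr 2
    have := nat_ident i
    nlinarith
  have hlc : S0 * S2 ≤ 2 * S1 ^ 2 := by
    apply lc_moment
    intro i k a h
    simp only [hw]
    have := ew_lc hl (i + (j+1)) (k + (j+1)) a (by omega)
    simpa [add_assoc] using this
  have hj : ew l j ≠ ∞ := ENNReal.ofReal_ne_top
  have h1 : S1 ≠ ∞ := by
    have : S1 ≤ ENNReal.ofReal l * ew l j + ENNReal.ofReal l * S0 := id1 ▸ le_self_add
    exact ne_top_of_le_ne_top (by finiteness) this
  have h2 : S2 ≠ ∞ := by
    have : S2 ≤ ENNReal.ofReal l * (S1 + S0) := id2 ▸ le_self_add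
    exact ne_top_of_le_ne_top (by finiteness) this
  have hpos : 0 < S0 := by
    have : w 0 ≤ S0 := ENNReal.le_tsum 0
    refine lt_of_lt_of_le ?_ this
    simp [hw, ew, pw_pos hl]
  have ejr : (ew l j).toReal = pw l j := ENNReal.toReal_ofReal (pw_pos hl _).le
  refine ⟨S0.toReal, S1.toReal, S2.toReal, by positivity, (ENNReal.ofReal_toReal h0).symm,
    ENNReal.toReal_pos hpos.ne' h0, ?_, ?_, ?_⟩
  · have := congrArg ENNReal.toReal id1
    rw [ENNReal.toReal_add (by finiteness) (by finiteness), ENNReal.toReal_add (by finiteness) (by finiteness)] at this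
    simp only [ENNReal.toReal_mul, ENNReal.toReal_natCast, ENNReal.toReal_ofReal hl.le, ejr] at this
    push_cast at this; exact this
  · have := congrArg ENNReal.toReal id2
    rw [ENNReal.toReal_add (by finiteness) (by finiteness), ENNReal.toReal_mul, ENNReal.toReal_mul, ENNReal.toReal_add (by finiteness) (by finiteness)] at this
    simp only [ENNReal.toReal_natCast, ENNReal.toReal_ofReal hl.le] at this
    push_cast at this; exact this
  · have := ENNReal.toReal_mono (by finiteness) hlc
    simpa [ENNReal.toReal_mul] using this

lemma lower_tail {l : ℝ} (hl : 0 < l) (j : ℕ) :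
    ∃ F S1 S2 : ℝ, 0 ≤ S1 ∧ (∑ i ∈ Finset.range (j + 1), pw l i) = F ∧ 0 < F ∧
      j * F + l * pw l j = S1 + l * F ∧ j * S1 + l * F = S2 + S1 + l * S1 + l * pw l j ∧
      F * S2 ≤ 2 * S1 ^ 2 := by
  set w : ℕ → ℝ≥0∞ := fun i => if i ≤ j then ew l (j - i) else 0 with hw
  set S0 := ∑' i, w i with hS0
  set S1 := ∑' i : ℕ, (i : ℝ≥0∞) * w i with hS1
  set S2 := ∑' i : ℕ, ((i * (i - 1) : ℕ) : ℝ≥0∞) * w i with hS2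
  have hj : ew l j ≠ ∞ := ENNReal.ofReal_ne_top
  have hw0 : w 0 = ew l j := by simp [hw]
  have hS0f : S0 = ENNReal.ofReal (∑ i ∈ Finset.range (j + 1), pw l i) := by
    rw [ENNReal.ofReal_sum_of_nonneg (fun i _ => (pw_pos hl i).le), hS0,
      tsum_eq_sum (s := Finset.range (j + 1)), ← Finset.sum_range_reflect]
    · apply Finset.sum_congr rfl
      intro i hi
      have := Finset.mem_range.1 hi
      simp only [hw]
      rw [if_pos (by omega)]; unfold ew; congr 2; omega
    · intro i hi; simp at hi; simp [hw]; omega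
  have hrec : ∀ i : ℕ, (j : ℝ≥0∞) * w i = i * w i + ENNReal.ofReal l * w (i + 1) := by
    intro i
    simp only [hw]
    rcases lt_trichotomy i j with h | h | h
    · rw [if_pos h.le, if_pos (by omega)]
      obtain ⟨m, rfl⟩ : ∃ m, j = i + m + 1 := ⟨j - i - 1, by omega⟩
      rw [show i + m + 1 - (i + 1) = m by omega, ← ew_succ hl, show i + m + 1 - i = m + 1 by omega]
      push_cast; ring
    · subst h; simp
    · rw [if_neg (by omega), if_neg (by omega)]; simp
  have hshift : S0 = ew l j + ∑' i, w (i + 1) := by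
    rw [hS0, esplit w 1]; simp [hw0]
  have hshift1 : S1 = ∑' i : ℕ, (i : ℝ≥0∞) * w (i + 1) + ∑' i, w (i + 1) := by
    rw [hS1, esplit (fun i : ℕ => (i : ℝ≥0∞) * w i) 1, ← ENNReal.tsum_add]
    simp [add_mul]
  have id1 : (j : ℝ≥0∞) * S0 + ENNReal.ofReal l * ew l j = S1 + ENNReal.ofReal l * S0 := by
    rw [hshift, mul_add (ENNReal.ofReal l), ← hshift, hS0, hS1, ← ENNReal.tsum_mul_left,
      tsum_congr hrec, ENNReal.tsum_add, ENNReal.tsum_mul_left]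
    ring
  have id2 : (j : ℝ≥0∞) * S1 + ENNReal.ofReal l * S0
      = S2 + S1 + ENNReal.ofReal l * S1 + ENNReal.ofReal l * ew l j := by
    have e : (j : ℝ≥0∞) * S1 = S2 + S1 + ENNReal.ofReal l * ∑' i : ℕ, (i : ℝ≥0∞) * w (i + 1) := by
      rw [hS2, hS1, ← ENNReal.tsum_mul_left, ← ENNReal.tsum_mul_left, ← ENNReal.tsum_add, ← ENNReal.tsum_add]
      congr 1; ext i
      rw [mul_left_comm, hrec, mul_add, ← add_mul, ← mul_assoc, ← Nat.cast_mul, nat_ident i]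
      push_cast; ring
    have e' : ENNReal.ofReal l * S1 = ENNReal.ofReal l * ∑' i : ℕ, (i : ℝ≥0∞) * w (i + 1) +
        ENNReal.ofReal l * ∑' i, w (i + 1) := by rw [← mul_add, ← hshift1]
    rw [e, hshift, e', mul_add]
    generalize ∑' i : ℕ, (i : ℝ≥0∞) * w (i + 1) = U
    generalize ∑' i, w (i + 1) = V
    ring
  have h0 : S0 ≠ ∞ := by rw [hS0f]; finiteness
  have hlc : S0 * S2 ≤ 2 * S1 ^ 2 := by
    apply lc_moment
    intro i k a h
    simp only [hw]
    by_cases hk : a + k ≤ j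
    · rw [if_pos (by omega), if_pos hk, if_pos (by omega), if_pos (by omega)]
      have := ew_lc hl (j - (a + k)) (j - (a + i)) a (by omega)
      rw [show a + (j - (a + i)) = j - i by omega, show a + (j - (a + k)) = j - k by omega] at this
      rw [mul_comm, mul_comm (ew l (j - (a + i)))]
      exact this
    · rw [if_neg hk]; simp
  have h1 : S1 ≠ ∞ := by
    have : S1 ≤ (j : ℝ≥0∞) * S0 + ENNReal.ofReal l * ew l j := id1 ▸ le_self_add
    exact ne_top_of_le_ne_top (by finiteness) this
  have h2 : S2 ≠ ∞ := by
    have : S2 ≤ (j : ℝ≥0∞) * S1 + ENNReal.ofReal l * S0 := by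
      rw [id2, add_assoc, add_assoc]; exact le_self_add
    exact ne_top_of_le_ne_top (by finiteness) this
  have ejr : (ew l j).toReal = pw l j := ENNReal.toReal_ofReal (pw_pos hl _).le
  have hFpos : 0 < ∑ i ∈ Finset.range (j + 1), pw l i :=
    Finset.sum_pos (fun i _ => pw_pos hl i) (by simp)
  refine ⟨S0.toReal, S1.toReal, S2.toReal, by positivity, ?_, ?_, ?_, ?_, ?_⟩
  · rw [hS0f, ENNReal.toReal_ofReal hFpos.le]
  · rw [hS0f, ENNReal.toReal_ofReal hFpos.le]; exact hFpos
  · have := congrArg ENNReal.toReal id1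
    rw [ENNReal.toReal_add (by finiteness) (by finiteness), ENNReal.toReal_add (by finiteness) (by finiteness)] at this
    simpa only [ENNReal.toReal_mul, ENNReal.toReal_natCast, ENNReal.toReal_ofReal hl.le, ejr] using this
  · have := congrArg ENNReal.toReal id2
    rw [ENNReal.toReal_add (by finiteness) (by finiteness), ENNReal.toReal_add (by finiteness) (by finiteness),
      ENNReal.toReal_add (by finiteness) (by finiteness), ENNReal.toReal_add (by finiteness) (by finiteness)] at this
    simpa only [ENNReal.toReal_mul, ENNReal.toReal_natCast, ENNReal.toReal_ofReal hl.le, ejr] using this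
  · have := ENNReal.toReal_mono (by finiteness) hlc
    simpa [ENNReal.toReal_mul] using this

lemma tails_alg {l j F Q P S1 S2 R1 R2 : ℝ} (hl : 0 < l) (hS1 : 0 ≤ S1) (hF : 0 < F) (hQ : 0 < Q)
    (hR1 : 0 ≤ R1) (hFQ1 : F + Q = 1) (hPpos : 0 < P)
    (e1 : j * F + P = S1 + l * F) (e2 : j * S1 + l * F = S2 + S1 + l * S1 + P)
    (e3 : F * S2 ≤ 2 * S1 ^ 2)
    (f1 : R1 + (j + 1) * Q = P + l * Q) (f2 : R2 + (j + 2) * R1 = l * (R1 + Q))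
    (f3 : Q * R2 ≤ 2 * R1 ^ 2) :
    F * Q ≤ min 1 (1.4 / Real.sqrt l) * P := by
  obtain ⟨x, hx⟩ : ∃ x, x = P / F := ⟨_, rfl⟩
  obtain ⟨y, hy⟩ : ∃ y, y = P / Q := ⟨_, rfl⟩
  have hPx : P = x * F := by rw [hx]; field_simp
  have hPy : P = y * Q := by rw [hy]; field_simp
  have hxp : 0 < x := by rw [hx]; positivity
  have hyp : 0 < y := by rw [hy]; positivity
  obtain ⟨m, hm⟩ : ∃ m, m = S1 / F := ⟨_, rfl⟩
  have hS1m : S1 = m * F := by rw [hm]; field_simp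
  have hm0 : 0 ≤ m := by rw [hm]; positivity
  obtain ⟨n, hn⟩ : ∃ n, n = R1 / Q := ⟨_, rfl⟩
  have hR1n : R1 = n * Q := by rw [hn]; field_simp
  have hn0 : 0 ≤ n := by rw [hn]; positivity
  have a1 : j + x = m + l := by
    apply mul_right_cancel₀ hF.ne'
    rw [hPx, hS1m] at e1; linarith
  have b1 : n + (j + 1) = y + l := by
    apply mul_right_cancel₀ hQ.ne'
    rw [hPy, hR1n] at f1; linarith
  have a3 : j * m + l - m - l * m - x ≤ 2 * m ^ 2 := by
    have : F ^ 2 * (j * m + l - m - l * m - x) ≤ F ^ 2 * (2 * m ^ 2) := by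
      rw [hS1m] at e2 e3; rw [hPx] at e2
      have : S2 = F * (j * m + l - m - l * m - x) := by linarith
      rw [this] at e3; linarith
    exact le_of_mul_le_mul_left this (by positivity)
  have b3 : l * (n + 1) - (j + 2) * n ≤ 2 * n ^ 2 := by
    have : Q ^ 2 * (l * (n + 1) - (j + 2) * n) ≤ Q ^ 2 * (2 * n ^ 2) := by
      rw [hR1n] at f2 f3
      have : R2 = Q * (l * (n + 1) - (j + 2) * n) := by linarith
      rw [this] at f3; linarith
    exact le_of_mul_le_mul_left this (by positivity)
  have k1 : l ≤ (x - (l - j - 1)) * (2 * x - (l - j - 1) - 1) := by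
    obtain rfl : j = m + l - x := by linarith
    ring_nf at a3 ⊢
    linarith
  have k2 : l ≤ (y + (l - j - 1)) * (2 * y + (l - j - 1) + 1) := by
    obtain rfl : j = y + l - n - 1 := by linarith
    ring_nf at b3 ⊢
    linarith
  have key := final_alg l x y (l - j - 1) hxp hyp (by linarith) (by linarith) k1 k2
  have hxy : x + y = m + n + 1 := by linarith
  have hPFQ : P = (x + y) * (F * Q) := by
    calc P = P * (F + Q) := by rw [hFQ1, mul_one]
      _ = (y * Q) * F + (x * F) * Q := by rw [← hPx, ← hPy]; ring
      _ = _ := by ring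
  have hpos : 0 < F * Q := by positivity
  have hsq : 0 < Real.sqrt l := Real.sqrt_pos.2 hl
  have hmin : 1 ≤ min 1 (1.4 / Real.sqrt l) * (x + y) := by
    rcases min_choice 1 (1.4 / Real.sqrt l) with h | h
    · rw [h]; linarith
    · rw [h, div_mul_eq_mul_div, le_div_iff₀ hsq, one_mul]
      apply Real.sqrt_le_iff.2
      constructor
      · positivity
      · rw [mul_pow]; norm_num at key ⊢; exact key
  calc F * Q = 1 * (F * Q) := (one_mul _).symm
    _ ≤ (min 1 (1.4 / Real.sqrt l) * (x + y)) * (F * Q) := by gcongr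
    _ = min 1 (1.4 / Real.sqrt l) * P := by rw [mul_assoc, ← hPFQ]

lemma tails_bound {l : ℝ} (hl : 0 < l) (j : ℕ) :
    let F := ∑ i ∈ Finset.range (j + 1), pw l i
    F * (1 - F) ≤ min 1 (1.4 / Real.sqrt l) * (l * pw l j) := by
  intro F
  obtain ⟨F', S1, S2, hS1, hF', hF, e1, e2, e3⟩ := lower_tail hl j
  obtain ⟨Q, R1, R2, hR1, hQe, hQ, f1, f2, f3⟩ := upper_tail hl j
  have hFF : F' = F := hF'.symm
  subst hFF
  have hFQ : Q = 1 - F := by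
    have h := esplit (ew l) (j + 1)
    rw [ew_sum hl, hQe] at h
    unfold ew at h
    rw [← ENNReal.ofReal_sum_of_nonneg (fun i _ => (pw_pos hl i).le),
      ← ENNReal.ofReal_add hF.le hQ.le] at h
    have h' := congrArg ENNReal.toReal h
    rw [ENNReal.toReal_ofReal (by positivity)] at h'
    simp at h'
    change 1 = F + Q at h'
    linarith
  rw [← hFQ]
  have hFQ1 : F + Q = 1 := by linarith
  obtain ⟨P, hP⟩ : ∃ P, P = l * pw l j := ⟨_, rfl⟩
  have hPpos : 0 < P := by rw [hP]; exact mul_pos hl (pw_pos hl j)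
  rw [← hP] at e1 e2 f1 ⊢
  exact tails_alg hl hS1 hF hQ hR1 hFQ1 hPpos e1 e2 e3 f1 f2 f3

lemma poisson_eq (l : ℝ) : poissonMeasure l = Measure.sum fun k : ℕ => ew l k • Measure.dirac k := rfl

lemma poisson_prob {l : ℝ} (hl : 0 < l) : IsProbabilityMeasure (poissonMeasure l) := by
  constructor
  rw [poisson_eq, Measure.sum_apply _ MeasurableSet.univ]
  simpa using ew_sum hl

lemma poisson_singleton (l : ℝ) (k : ℕ) : poissonMeasure l {k} = ew l k := by
  rw [poisson_eq, Measure.sum_apply _ (measurableSet_singleton k), tsum_eq_single k]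
  · simp
  · intro b hb; simp [hb]

lemma poisson_integral {l : ℝ} (hl : 0 < l) (g : ℕ → ℝ) (hg : ∀ n, g n ∈ Set.Icc (0:ℝ) 1) :
    ∫ n, g n ∂(poissonMeasure l) = ∑' n, pw l n * g n := by
  have := poisson_prob hl
  have hint : Integrable g (poissonMeasure l) :=
    Integrable.of_bound (Measurable.of_discrete).aestronglyMeasurable 1
      (Filter.Eventually.of_forall fun n => by
        rw [Real.norm_eq_abs, abs_le]; constructor <;> linarith [(hg n).1, (hg n).2])
  rw [integral_countable' hint]
  congr 1; ext n
  rw [measureReal_def, poisson_singleton, ew, ENNReal.toReal_ofReal (pw_pos hl n).le, smul_eq_mul]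

lemma stein_exists {l : ℝ} (hl : 0 < l) (g : ℕ → ℝ) (hg : ∀ n, g n ∈ Set.Icc (0:ℝ) 1) :
    ∃ f : ℕ → ℝ, (∀ n, |f n| ≤ min 1 (1.4 / Real.sqrt l)) ∧
      ∀ n : ℕ, l * f (n + 1) - n * f n = g n - ∫ n, g n ∂(poissonMeasure l) := by
  rw [poisson_integral hl g hg]
  set m := ∑' n, pw l n * g n with hm
  have hα : 0 ≤ min 1 (1.4 / Real.sqrt l) := by positivity
  set D : ℕ → ℝ := fun n => ∑ i ∈ Finset.range n, (g i - m) * pw l i with hD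
  refine ⟨fun n => match n with | 0 => 0 | n + 1 => D (n + 1) / (l * pw l n), ?_, ?_⟩
  · intro n
    rcases n with _ | j
    · simpa using hα
    · simp only
      have hP : 0 < l * pw l j := mul_pos hl (pw_pos hl j)
      rw [abs_div, abs_of_pos hP, div_le_iff₀ hP]
      refine le_trans ?_ (tails_bound hl j)
      set F := ∑ i ∈ Finset.range (j + 1), pw l i with hF
      have hs : Summable fun n => pw l n * g n :=
        Summable.of_nonneg_of_le (fun n => mul_nonneg (pw_pos hl n).le (hg n).1)
          (fun n => mul_le_of_le_one_right (pw_pos hl n).le (hg n).2) (pw_hasSum l).summable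
      have h1 := hs.sum_add_tsum_nat_add (j + 1)
      have h2 := (pw_hasSum l).summable.sum_add_tsum_nat_add (j + 1)
      rw [(pw_hasSum l).tsum_eq] at h2
      set L := ∑ i ∈ Finset.range (j + 1), pw l i * g i with hL
      set U := ∑' i, pw l (i + (j + 1)) * g (i + (j + 1)) with hU
      have hL0 : 0 ≤ L := Finset.sum_nonneg fun n _ => mul_nonneg (pw_pos hl n).le (hg n).1
      have hLF : L ≤ F := Finset.sum_le_sum fun n _ => mul_le_of_le_one_right (pw_pos hl n).le (hg n).2
      have hU0 : 0 ≤ U := tsum_nonneg fun n => mul_nonneg (pw_pos hl _).le (hg _).1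
      have hUQ : U ≤ 1 - F := by
        have : U ≤ ∑' i, pw l (i + (j + 1)) :=
          Summable.tsum_le_tsum (fun n => mul_le_of_le_one_right (pw_pos hl _).le (hg _).2)
            ((summable_nat_add_iff (j+1)).2 hs) ((summable_nat_add_iff (j+1)).2 (pw_hasSum l).summable)
        linarith
      have hDe : D (j + 1) = L - m * F := by
        simp only [hD, hL, hF]
        rw [Finset.mul_sum, ← Finset.sum_sub_distrib]
        exact Finset.sum_congr rfl fun i _ => by ring
      have hmLU : m = L + U := h1.symm
      have hF0 : 0 ≤ F := hL0.trans hLF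
      rw [hDe, hmLU, abs_le]
      constructor <;> nlinarith
  · intro n
    have hp := pw_pos hl n
    have h1 : l * (D (n + 1) / (l * pw l n)) = D (n + 1) / pw l n := by field_simp
    have hDs : D (n + 1) = D n + (g n - m) * pw l n := Finset.sum_range_succ _ _
    rcases n with _ | j
    · simp only [h1, hDs]
      simp only [hD, Finset.range_zero, Finset.sum_empty]
      field_simp; simp
    · simp only [h1, hDs]
      have h2 := pw_succ l j
      rw [← h2]
      push_cast
      have : (j : ℝ) + 1 ≠ 0 := by positivity
      field_simp; ring

open Classical in
noncomputable def steinF (l : ℝ) (g : ℕ → ℝ) : ℕ → ℝ :=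
  if hx : 0 < l ∧ ∀ n, g n ∈ Set.Icc (0:ℝ) 1 then (stein_exists hx.1 g hx.2).choose else 0

lemma steinF_spec {l : ℝ} (hl : 0 < l) (g : ℕ → ℝ) (hg : ∀ n, g n ∈ Set.Icc (0:ℝ) 1) :
    (∀ n, |steinF l g n| ≤ min 1 (1.4 / Real.sqrt l)) ∧
      ∀ n : ℕ, l * steinF l g (n + 1) - n * steinF l g n = g n - ∫ n, g n ∂(poissonMeasure l) := by
  unfold steinF
  rw [dif_pos ⟨hl, hg⟩]
  exact (stein_exists hl g hg).choose_spec

def mixv {d : ℕ} (k : ℕ) (z w : Fin d → ℕ) : Fin d → ℕ := fun i => if i.val < k then z i else w i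

noncomputable def hyb {d : ℕ} (lam : Fin d → ℝ) (h : (Fin d → ℕ) → ℝ) (k : ℕ) (w : Fin d → ℕ) : ℝ :=
  ∫ z, h (mixv k z w) ∂(Measure.pi fun k => poissonMeasure (lam k))

lemma bdd_int {α : Type*} [MeasurableSpace α] [DiscreteMeasurableSpace α] [Countable α]
    (μ : Measure α) [IsProbabilityMeasure μ] (φ : α → ℝ) (C : ℝ) (hφ : ∀ x, |φ x| ≤ C) :
    Integrable φ μ :=
  Integrable.of_bound (Measurable.of_discrete).aestronglyMeasurable C
      (Filter.Eventually.of_forall fun n => hφ n)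

lemma abs_le_one_of_mem {x : ℝ} (hx : x ∈ Set.Icc (0:ℝ) 1) : |x| ≤ 1 := by
  rw [abs_le]; constructor <;> linarith [hx.1, hx.2]

lemma hyb_mem {d : ℕ} (lam : Fin d → ℝ) (hlam : ∀ k, 0 < lam k) (h : (Fin d → ℕ) → ℝ)
    (hh : ∀ x, h x ∈ Set.Icc (0 : ℝ) 1) (k : ℕ) (w : Fin d → ℕ) :
    hyb lam h k w ∈ Set.Icc (0:ℝ) 1 := by
  have := fun k => poisson_prob (hlam k)
  unfold hyb
  constructor
  · exact integral_nonneg fun z => (hh _).1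
  · calc _ ≤ ∫ z, (1:ℝ) ∂(Measure.pi fun k => poissonMeasure (lam k)) :=
        integral_mono (bdd_int _ _ 1 fun z => abs_le_one_of_mem (hh _)) (integrable_const _) fun z => (hh _).2
      _ = 1 := by simp

lemma pi_update {d : ℕ} (ν : Fin d → Measure ℕ) [∀ i, IsProbabilityMeasure (ν i)] (k : Fin d) :
    ((ν k).prod (Measure.pi ν)).map (fun p : ℕ × (Fin d → ℕ) => Function.update p.2 k p.1)
      = Measure.pi ν := by
  symm
  apply Measure.pi_eq
  intro s hs
  rw [Measure.map_apply (Measurable.of_discrete) (MeasurableSet.of_discrete)]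
  have : (fun p : ℕ × (Fin d → ℕ) => Function.update p.2 k p.1) ⁻¹' (Set.univ.pi s)
      = s k ×ˢ (Set.univ.pi (Function.update s k Set.univ)) := by
    ext ⟨n, z⟩
    simp only [Set.mem_preimage, Set.mem_pi, Set.mem_univ, true_imp_iff, Set.mem_prod]
    constructor
    · intro H
      refine ⟨by simpa using H k, fun i => ?_⟩
      by_cases hi : i = k
      · subst hi; simp
      · simpa [hi] using H i
    · rintro ⟨H1, H2⟩ i
      by_cases hi : i = k
      · subst hi; simpa using H1
      · simpa [hi] using H2 i
  rw [this, Measure.prod_prod, Measure.pi_pi, ← Finset.mul_prod_erase _ _ (Finset.mem_univ k),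
    ← Finset.mul_prod_erase _ (fun i => ν i (s i)) (Finset.mem_univ k)]
  simp only [Function.update_self, measure_univ, one_mul]
  congr 1
  refine Finset.prod_congr rfl fun i hi => ?_
  rw [Function.update_of_ne (Finset.ne_of_mem_erase hi)]

lemma hyb_succ {d : ℕ} (lam : Fin d → ℝ) (hlam : ∀ k, 0 < lam k) (h : (Fin d → ℕ) → ℝ)
    (hh : ∀ x, h x ∈ Set.Icc (0 : ℝ) 1) (k : Fin d) (w : Fin d → ℕ) :
    ∫ n, hyb lam h k.val (Function.update w k n) ∂(poissonMeasure (lam k)) = hyb lam h (k.val + 1) w := by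
  have := fun k => poisson_prob (hlam k)
  unfold hyb
  have e := pi_update (fun k => poissonMeasure (lam k)) k
  conv_rhs => rw [← e]
  rw [integral_map (Measurable.of_discrete).aemeasurable (Measurable.of_discrete).aestronglyMeasurable,
    integral_prod _ (bdd_int _ _ 1 fun z => abs_le_one_of_mem (hh _))]
  congr 1; ext n; congr 1; ext z; congr 1
  ext i
  unfold mixv
  by_cases hi : i = k
  · subst hi; simp
  · have : i.val ≠ k.val := fun h => hi (Fin.ext h)
    simp only [Function.update_of_ne hi]
    by_cases h1 : i.val < k.val
    · rw [if_pos h1, if_pos (by omega)]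
    · rw [if_neg h1, if_neg (by omega)]

lemma step {Ω : Type*} [MeasurableSpace Ω] (ℙ : Measure Ω) [IsProbabilityMeasure ℙ]
    (d : ℕ) (W W' : Ω → Fin d → ℕ) (hWm : Measurable W) (hW'm : Measurable W')
    (hexch : ℙ.map (fun ω => (W ω, W' ω)) = ℙ.map (fun ω => (W' ω, W ω)))
    (lam : Fin d → ℝ) (hlam : ∀ k, ∫ ω, (W ω k : ℝ) ∂ℙ = lam k)
    (hlampos : ∀ k, 0 < lam k)
    (h : (Fin d → ℕ) → ℝ) (hh : ∀ x, h x ∈ Set.Icc (0 : ℝ) 1)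
    (c : ℝ) (k : Fin d) :
    |(∫ ω, hyb lam h k.val (W ω) ∂ℙ) - ∫ ω, hyb lam h (k.val + 1) (W ω) ∂ℙ| ≤
      min 1 (1.4 / Real.sqrt (lam k)) *
        ((∫ ω, |lam k - c *
            (ℙ[Set.indicator {ω' | W' ω' k = W ω' k + 1 ∧ ∀ j, k < j → W' ω' j = W ω' j}
                (fun _ => (1 : ℝ)) | MeasurableSpace.comap W inferInstance]) ω| ∂ℙ) +
         (∫ ω, |(W ω k : ℝ) - c *
            (ℙ[Set.indicator {ω' | W ω' k = W' ω' k + 1 ∧ ∀ j, k < j → W' ω' j = W ω' j}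
                (fun _ => (1 : ℝ)) | MeasurableSpace.comap W inferInstance]) ω| ∂ℙ)) := by
  set α := min 1 (1.4 / Real.sqrt (lam k)) with hα
  set A : Set Ω := {ω' | W' ω' k = W ω' k + 1 ∧ ∀ j, k < j → W' ω' j = W ω' j} with hA
  set B : Set Ω := {ω' | W ω' k = W' ω' k + 1 ∧ ∀ j, k < j → W' ω' j = W ω' j} with hB
  set φ : (Fin d → ℕ) → ℕ → ℝ :=
    fun w => steinF (lam k) (fun n => hyb lam h k.val (Function.update w k n)) with hφ
  have hspec := fun w : Fin d → ℕ => steinF_spec (hlampos k)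
    (fun n => hyb lam h k.val (Function.update w k n)) (fun n => hyb_mem lam hlampos h hh _ _)
  have hφb : ∀ w n, |φ w n| ≤ α := fun w n => (hspec w).1 n
  have hφe : ∀ w : Fin d → ℕ, lam k * φ w (w k + 1) - w k * φ w (w k)
      = hyb lam h k.val w - hyb lam h (k.val + 1) w := by
    intro w
    have := (hspec w).2 (w k)
    rw [hyb_succ lam hlampos h hh k w, Function.update_eq_self] at this
    exact this
  have hφc : ∀ w w' : Fin d → ℕ, (∀ j, k < j → w' j = w j) → φ w = φ w' := by
    intro w w' H
    simp only [hφ]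
    congr 1; ext n; unfold hyb; congr 1; ext z; congr 1; ext i
    unfold mixv
    split_ifs with h1
    · rfl
    · by_cases hi : i = k
      · subst hi; simp
      · rw [Function.update_of_ne hi, Function.update_of_ne hi]
        refine (H i ?_).symm
        exact lt_of_le_of_ne (not_lt.1 h1) (Ne.symm hi)
  have hpair : Measurable (fun ω => (W ω, W' ω)) := hWm.prodMk hW'm
  have hpair' : Measurable (fun ω => (W' ω, W ω)) := hW'm.prodMk hWm
  have hAm : MeasurableSet A := by
    have : A = (fun ω => (W ω, W' ω)) ⁻¹' {p | p.2 k = p.1 k + 1 ∧ ∀ j, k < j → p.2 j = p.1 j} := rfl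
    rw [this]; exact hpair MeasurableSet.of_discrete
  have hBm : MeasurableSet B := by
    have : B = (fun ω => (W ω, W' ω)) ⁻¹' {p | p.1 k = p.2 k + 1 ∧ ∀ j, k < j → p.2 j = p.1 j} := rfl
    rw [this]; exact hpair MeasurableSet.of_discrete
  set m0 : MeasurableSpace Ω := MeasurableSpace.comap W inferInstance with hm0
  have hm : m0 ≤ _ := hWm.comap_le
  have hWm0 : Measurable[m0] W := comap_measurable W
  set a : Ω → ℝ := fun ω => φ (W ω) (W ω k + 1) with ha
  set b : Ω → ℝ := fun ω => φ (W ω) (W ω k) with hb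
  have ham : StronglyMeasurable[m0] a :=
    ((Measurable.of_discrete (f := fun w : Fin d → ℕ => φ w (w k + 1))).comp hWm0).stronglyMeasurable
  have hbm : StronglyMeasurable[m0] b :=
    ((Measurable.of_discrete (f := fun w : Fin d → ℕ => φ w (w k))).comp hWm0).stronglyMeasurable
  have hab : ∀ ω, |a ω| ≤ α := fun ω => hφb _ _
  have hbb : ∀ ω, |b ω| ≤ α := fun ω => hφb _ _
  have hmul : ∀ (u : Ω → ℝ), StronglyMeasurable[m0] u → (∀ ω, |u ω| ≤ α) → ∀ v : Ω → ℝ,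
      Integrable v ℙ → Integrable (fun ω => u ω * v ω) ℙ := by
    intro u hu hub v hv
    exact hv.bdd_mul (hu.mono hm).aestronglyMeasurable (Filter.Eventually.of_forall hub)
  set IA : Ω → ℝ := A.indicator fun _ => 1 with hIA
  set IB : Ω → ℝ := B.indicator fun _ => 1 with hIB
  have hIAi : Integrable IA ℙ := (integrable_const 1).indicator hAm
  have hIBi : Integrable IB ℙ := (integrable_const 1).indicator hBm
  have hcond : ∀ (u : Ω → ℝ), StronglyMeasurable[m0] u → (∀ ω, |u ω| ≤ α) → ∀ v : Ω → ℝ,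
      Integrable v ℙ → ∫ ω, u ω * (ℙ[v | m0]) ω ∂ℙ = ∫ ω, u ω * v ω ∂ℙ := by
    intro u hu hub v hv
    have h1 := condExp_mul_of_stronglyMeasurable_left (μ := ℙ) hu (hmul u hu hub v hv) hv
    have h2 := integral_condExp (μ := ℙ) (f := fun ω => u ω * v ω) hm
    rw [← h2]
    exact (integral_congr_ae h1).symm
  have hex : ∫ ω, a ω * IA ω ∂ℙ = ∫ ω, b ω * IB ω ∂ℙ := by
    classical
    set G : (Fin d → ℕ) × (Fin d → ℕ) → ℝ := fun p =>
      if p.2 k = p.1 k + 1 ∧ ∀ j, k < j → p.2 j = p.1 j then φ p.1 (p.1 k + 1) else 0 with hG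
    have hGm : Measurable G := Measurable.of_discrete
    have e1 : ∫ ω, a ω * IA ω ∂ℙ = ∫ ω, G (W ω, W' ω) ∂ℙ := by
      congr 1; ext ω
      simp only [hG, hIA, ha, Set.indicator_apply, hA, Set.mem_ofPred_eq]
      split_ifs <;> simp
    have e2 : ∫ ω, b ω * IB ω ∂ℙ = ∫ ω, G (W' ω, W ω) ∂ℙ := by
      congr 1; ext ω
      simp only [hG, hIB, hb, Set.indicator_apply, hB, Set.mem_ofPred_eq]
      by_cases hc : W ω k = W' ω k + 1 ∧ ∀ j, k < j → W' ω j = W ω j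
      · rw [if_pos hc, if_pos ⟨hc.1, fun j hj => (hc.2 j hj).symm⟩, hφc _ _ hc.2, hc.1, mul_one]
      · rw [if_neg hc, if_neg (fun hc' => hc ⟨hc'.1, fun j hj => (hc'.2 j hj).symm⟩), mul_zero]
    rw [e1, e2, ← integral_map hpair.aemeasurable hGm.aestronglyMeasurable, hexch,
      integral_map hpair'.aemeasurable hGm.aestronglyMeasurable]
  have hWi : Integrable (fun ω => (W ω k : ℝ)) ℙ := by
    by_contra hc
    have := hlam k
    rw [integral_undef hc] at this
    exact (hlampos k).ne this
  set PA := ℙ[IA | m0] with hPA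
  set PB := ℙ[IB | m0] with hPB
  have hPAi : Integrable PA ℙ := integrable_condExp
  have hPBi : Integrable PB ℙ := integrable_condExp
  have hX : Integrable (fun ω => lam k - c * PA ω) ℙ := (integrable_const _).sub (hPAi.const_mul c)
  have hY : Integrable (fun ω => (W ω k : ℝ) - c * PB ω) ℙ := hWi.sub (hPBi.const_mul c)
  have hHi : ∀ n, Integrable (fun ω => hyb lam h n (W ω)) ℙ := fun n =>
    Integrable.of_bound ((Measurable.of_discrete (f := hyb lam h n)).comp hWm).aestronglyMeasurable 1
      (Filter.Eventually.of_forall fun ω => abs_le_one_of_mem (hyb_mem lam hlampos h hh _ _))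
  have hAB : ∫ ω, a ω * PA ω ∂ℙ = ∫ ω, b ω * PB ω ∂ℙ := by
    rw [hcond a ham hab IA hIAi, hcond b hbm hbb IB hIBi, hex]
  have main : (∫ ω, hyb lam h k.val (W ω) ∂ℙ) - ∫ ω, hyb lam h (k.val + 1) (W ω) ∂ℙ =
      (∫ ω, a ω * (lam k - c * PA ω) ∂ℙ) - ∫ ω, b ω * ((W ω k : ℝ) - c * PB ω) ∂ℙ := by
    rw [← integral_sub (hHi _) (hHi _), ← integral_sub (hmul a ham hab _ hX) (hmul b hbm hbb _ hY)]
    have e : ∀ ω, a ω * (lam k - c * PA ω) - b ω * ((W ω k : ℝ) - c * PB ω)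
        = (hyb lam h k.val (W ω) - hyb lam h (k.val + 1) (W ω)) -
          (c * (a ω * PA ω) - c * (b ω * PB ω)) := by
      intro ω; rw [← hφe (W ω)]; simp only [ha, hb]; ring
    simp_rw [e]
    have i1 := (hmul a ham hab _ hPAi).const_mul c
    have i2 := (hmul b hbm hbb _ hPBi).const_mul c
    have i3 : Integrable (fun ω => c * (a ω * PA ω) - c * (b ω * PB ω)) ℙ := i1.sub i2
    have i4 : Integrable (fun ω => hyb lam h k.val (W ω) - hyb lam h (k.val + 1) (W ω)) ℙ :=
      (hHi _).sub (hHi _)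
    rw [integral_sub i4 i3, integral_sub i1 i2,
      integral_const_mul, integral_const_mul, hAB]
    simp
  have hbd : ∀ (u v : Ω → ℝ), (∀ ω, |u ω| ≤ α) → Integrable v ℙ →
      |∫ ω, u ω * v ω ∂ℙ| ≤ α * ∫ ω, |v ω| ∂ℙ := by
    intro u v hu hv
    rw [← integral_const_mul]
    refine norm_integral_le_of_norm_le (f := fun ω => u ω * v ω) (hv.abs.const_mul α)
      (Filter.Eventually.of_forall fun ω => ?_)
    rw [Real.norm_eq_abs, abs_mul]
    exact mul_le_mul_of_nonneg_right (hu ω) (abs_nonneg _)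
  rw [main, mul_add]
  exact (abs_sub _ _).trans (add_le_add (hbd a _ hab hX) (hbd b _ hbb hY))



/-- Multivariate Poisson approximation via an exchangeable pair `(W, W')` of `ℕ^d`-valued
random vectors: for `h : ℕ^d → [0,1]`, independent Poisson `Z_k` with means `λ_k`, and any
constants `c_k`,
`|E h(W) - E h(Z)| ≤ Σ_k α_k [E|λ_k - c_k ℙ(A_k|W)| + E|W_k - c_k ℙ(B_k|W)|]`,
where `α_k = min(1, 1.4 λ_k^{-1/2})`, `A_k = {W'_k = W_k + 1, W'_j = W_j ∀ j > k}` and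
`B_k = {W'_k = W_k - 1, W'_j = W_j ∀ j > k}`. -/
theorem multivariate_poisson_approx
    {Ω : Type*} [MeasurableSpace Ω] (ℙ : Measure Ω) [IsProbabilityMeasure ℙ]
    (d : ℕ) (W W' : Ω → Fin d → ℕ) (hWm : Measurable W) (hW'm : Measurable W')
    (hexch : ℙ.map (fun ω => (W ω, W' ω)) = ℙ.map (fun ω => (W' ω, W ω)))
    (lam : Fin d → ℝ) (hlam : ∀ k, ∫ ω, (W ω k : ℝ) ∂ℙ = lam k)
    (hlampos : ∀ k, 0 < lam k)
    (h : (Fin d → ℕ) → ℝ) (hh : ∀ x, h x ∈ Set.Icc (0 : ℝ) 1)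
    (c : Fin d → ℝ) :
    |(∫ ω, h (W ω) ∂ℙ) - ∫ z, h z ∂(Measure.pi fun k => poissonMeasure (lam k))| ≤
      ∑ k : Fin d, min 1 (1.4 / Real.sqrt (lam k)) *
        ((∫ ω, |lam k - c k *
            (ℙ[Set.indicator {ω' | W' ω' k = W ω' k + 1 ∧ ∀ j, k < j → W' ω' j = W ω' j}
                (fun _ => (1 : ℝ)) | MeasurableSpace.comap W inferInstance]) ω| ∂ℙ) +
         (∫ ω, |(W ω k : ℝ) - c k *
            (ℙ[Set.indicator {ω' | W ω' k = W' ω' k + 1 ∧ ∀ j, k < j → W' ω' j = W ω' j}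
                (fun _ => (1 : ℝ)) | MeasurableSpace.comap W inferInstance]) ω| ∂ℙ)) := by
  have H : ∀ n (hn : n ≤ d), |(∫ ω, h (W ω) ∂ℙ) - ∫ ω, hyb lam h n (W ω) ∂ℙ| ≤
      ∑ k : Fin n, min 1 (1.4 / Real.sqrt (lam (Fin.castLE hn k))) *
        ((∫ ω, |lam (Fin.castLE hn k) - c (Fin.castLE hn k) *
            (ℙ[Set.indicator {ω' | W' ω' (Fin.castLE hn k) = W ω' (Fin.castLE hn k) + 1 ∧ ∀ j, Fin.castLE hn k < j → W' ω' j = W ω' j}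
                (fun _ => (1 : ℝ)) | MeasurableSpace.comap W inferInstance]) ω| ∂ℙ) +
         (∫ ω, |(W ω (Fin.castLE hn k) : ℝ) - c (Fin.castLE hn k) *
            (ℙ[Set.indicator {ω' | W ω' (Fin.castLE hn k) = W' ω' (Fin.castLE hn k) + 1 ∧ ∀ j, Fin.castLE hn k < j → W' ω' j = W ω' j}
                (fun _ => (1 : ℝ)) | MeasurableSpace.comap W inferInstance]) ω| ∂ℙ)) := by
    have := fun k => poisson_prob (hlampos k)
    intro n
    induction n with
    | zero =>
      intro hn
      have : ∀ w, hyb lam h 0 w = h w := by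
        intro w
        have hmx : ∀ z, mixv 0 z w = w := fun z => by ext i; simp [mixv]
        simp [hyb, hmx]
      simp [this]
    | succ n ih =>
      intro hn
      rw [Fin.sum_univ_castSucc]
      have h1 := ih (by omega)
      have h2 := step ℙ d W W' hWm hW'm hexch lam hlam hlampos h hh (c ⟨n, hn⟩) ⟨n, hn⟩
      exact (abs_sub_le _ _ _).trans (add_le_add h1 h2)
  have Hd := H d le_rfl
  have := fun k => poisson_prob (hlampos k)
  have e : ∀ w, hyb lam h d w = ∫ z, h z ∂(Measure.pi fun k => poissonMeasure (lam k)) := by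
    intro w
    have hmx : ∀ z, mixv d z w = z := fun z => by ext i; simp [mixv]
    simp [hyb, hmx]
  simp_rw [e] at Hd
  rw [integral_const] at Hd
  simpa using Hd
end

section
/- Let n ≥ 1, let σ be a uniformly random permutation of ℤ/nℤ, let W_1 = #{i : σ(i) = i} and W_2 = #{i : σ(i) = i + 1 (mod n)}. Let (Z_1, Z_2) be a pair of independent Poisson random variables, each with mean 1. Then ‖L(W_1, W_2) - L(Z_1, Z_2)‖_TV ≤ 13/n. -/
open MeasureTheory

instance (n : ℕ) [NeZero n] : MeasurableSpace (Equiv.Perm (ZMod n)) := ⊤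

/-- The uniform distribution on the permutations of `ℤ/nℤ`. -/
noncomputable def uniformPermZ (n : ℕ) [NeZero n] : Measure (Equiv.Perm (ZMod n)) :=
  (Fintype.card (Equiv.Perm (ZMod n)) : ENNReal)⁻¹ • Measure.count


lemma jm_summ (h : ℕ → ℝ) (h0 : ∀ k, |h k| ≤ 1) :
    Summable (fun j : ℕ => (1 / (Nat.factorial j : ℝ)) * h j) := by
  have hs : Summable (fun j : ℕ => (1 / (Nat.factorial j : ℝ))) := by
    simpa using Real.summable_pow_div_factorial 1
  refine Summable.of_norm_bounded hs (fun j => ?_)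
  rw [norm_mul, Real.norm_eq_abs, Real.norm_eq_abs, abs_of_nonneg (by positivity)]
  exact mul_le_of_le_one_right (by positivity) (h0 j)

lemma jm_exp : HasSum (fun j : ℕ => (1 / (Nat.factorial j : ℝ))) (Real.exp 1) := by
  have := NormedSpace.expSeries_div_hasSum_exp (𝔸 := ℝ) 1
  rw [← Real.exp_eq_exp_ℝ] at this
  simpa using this

lemma jm_fact (k j : ℕ) : (k+1).factorial * (j+2).factorial ≤ (j + (k+1) + 1).factorial := by
  induction j with
  | zero => simp [Nat.factorial_succ]; nlinarith [Nat.factorial_pos k, Nat.mul_le_mul_right ((k+1)*k.factorial) (show 2 ≤ k+1+1 by omega)]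
  | succ j ih =>
    have e1 : j + 1 + (k+1) + 1 = (j + (k+1) + 1) + 1 := by ring
    rw [e1, Nat.factorial_succ, show j + 1 + 2 = (j+2)+1 by ring, Nat.factorial_succ (j+2)]
    calc (k+1).factorial * ((j+2+1) * (j+2).factorial) = (j+2+1) * ((k+1).factorial * (j+2).factorial) := by ring
      _ ≤ _ := Nat.mul_le_mul (by omega) ih

/-- solution of the Stein equation by recursion -/
noncomputable def jmF (g : ℕ → ℝ) : ℕ → ℝ
  | 0 => 0
  | k + 1 => g k + k * jmF g k

lemma jmF_sum (g : ℕ → ℝ) (k : ℕ) :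
    jmF g (k+1) = k.factorial * ∑ j ∈ Finset.range (k+1), (1 / (Nat.factorial j : ℝ)) * g j := by
  induction k with
  | zero => simp [jmF]
  | succ k ih =>
    rw [Finset.sum_range_succ, jmF, ih, Nat.factorial_succ]
    have : (k.factorial : ℝ) ≠ 0 := by positivity
    have : (k + 1 : ℝ) ≠ 0 := by positivity
    push_cast
    field_simp
    ring

lemma jm_stein (h : ℕ → ℝ) (h0 : ∀ k, 0 ≤ h k) (h1 : ∀ k, h k ≤ 1) :
    ∃ f : ℕ → ℝ, (∀ k : ℕ, f (k+1) - k * f k =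
      h k - ∑' j : ℕ, Real.exp (-1) * ((1 / (Nat.factorial j : ℝ)) * h j)) ∧
      ∀ k, |f (k+1)| ≤ 9/10 := by
  set E := ∑' j : ℕ, Real.exp (-1) * ((1 / (Nat.factorial j : ℝ)) * h j) with hE
  have hsum := jm_summ h (fun k => abs_le.2 ⟨by linarith [h0 k], h1 k⟩)
  have hE' : E = Real.exp (-1) * ∑' j : ℕ, ((1 / (Nat.factorial j : ℝ)) * h j) := tsum_mul_left
  set T := ∑' j : ℕ, ((1 / (Nat.factorial j : ℝ)) * h j) with hT
  have ee : Real.exp (-1) * Real.exp 1 = 1 := by rw [← Real.exp_add]; simp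
  have e1 := Real.exp_one_lt_d9
  have e2 := Real.exp_one_gt_d9
  have em : 1/10 ≤ Real.exp (-1) := by nlinarith [Real.exp_pos (-1)]
  have hTe : T = Real.exp 1 * E := by rw [hE', ← mul_assoc, mul_comm (Real.exp 1), ee, one_mul]
  have hT0 : h 0 ≤ T := by
    have := hsum.le_tsum 0 (fun j _ => mul_nonneg (by positivity) (h0 j))
    rw [← hT] at this
    simpa only [Nat.factorial_zero, Nat.cast_one, div_one, one_mul] using this
  have hT1 : T ≤ Real.exp 1 - 1 + h 0 := by
    have hs2 := jm_summ (fun j => 1 - h j) (fun k => abs_le.2 ⟨by linarith [h1 k], by linarith [h0 k]⟩)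
    have := hs2.le_tsum 0 (fun j _ => mul_nonneg (by positivity) (by linarith [h1 j]))
    have h3 : ∑' j : ℕ, (1 / (Nat.factorial j : ℝ)) * (1 - h j) = Real.exp 1 - T := by
      simp_rw [mul_sub, mul_one]
      rw [jm_exp.summable.tsum_sub hsum, jm_exp.tsum_eq]
    rw [h3] at this
    simp at this
    linarith
  have hEl : 0 ≤ E := by rw [hE']; exact mul_nonneg (Real.exp_pos _).le (by linarith [h0 0])
  have hEu : E ≤ 1 := by rw [hE']; nlinarith [Real.exp_pos (-1), h1 0]
  set g := fun k => h k - E with hg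
  have hgb : ∀ k, |g k| ≤ 1 := fun k => abs_le.2 ⟨by simp only [hg]; linarith [h0 k], by simp only [hg]; linarith [h1 k]⟩
  have hgs := jm_summ g hgb
  have hg0 : ∑' j : ℕ, (1 / (Nat.factorial j : ℝ)) * g j = 0 := by
    simp only [hg, mul_sub]
    rw [hsum.tsum_sub (jm_exp.summable.mul_right E), tsum_mul_right, jm_exp.tsum_eq, ← hT, hTe]
    ring
  refine ⟨jmF g, fun k => by simp [jmF, hg], fun k => ?_⟩
  rcases k with _ | k
  · simp only [jmF, hg]
    have hh0 := h0 0
    have hh1 := h1 0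
    rw [abs_le, hE']
    have p := Real.exp_pos (-1)
    have a1 : Real.exp (-1) * h 0 ≤ Real.exp (-1) * T := by gcongr
    have a2 : Real.exp (-1) * T ≤ Real.exp (-1) * (Real.exp 1 - 1 + h 0) := by gcongr
    constructor
    · simp; nlinarith
    · simp; nlinarith
  · rw [jmF_sum]
    have hsplit := hgs.sum_add_tsum_nat_add (k + 1 + 1)
    rw [hg0] at hsplit
    have : ∑ j ∈ Finset.range (k+1+1), (1 / (Nat.factorial j : ℝ)) * g j =
      - ∑' j : ℕ, (1 / (Nat.factorial (j + (k + 1 + 1)) : ℝ)) * g (j + (k + 1 + 1)) := by linarith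
    rw [this, mul_neg, abs_neg, ← tsum_mul_left]
    have hB : HasSum (fun j : ℕ => (1 / (Nat.factorial (j + 2) : ℝ))) (Real.exp 1 - 2) := by
      have := (hasSum_nat_add_iff' 2).2 jm_exp
      norm_num [Finset.sum_range_succ] at this ⊢
      exact this
    have := tsum_of_norm_bounded (f := fun j : ℕ => ((k+1).factorial : ℝ) * ((1 / (Nat.factorial (j + (k + 1 + 1)) : ℝ)) * g (j + (k + 1 + 1)))) hB (fun j => by
      rw [norm_mul, norm_mul, Real.norm_eq_abs, Real.norm_eq_abs, Real.norm_eq_abs, abs_of_nonneg (by positivity), abs_of_nonneg (by positivity)]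
      have b := hgb (j + (k+1+1))
      have c : ((k+1).factorial : ℝ) * (j+2).factorial ≤ (j + (k+1) + 1).factorial := by exact_mod_cast jm_fact k j
      calc _ ≤ ((k+1).factorial : ℝ) * ((1 / (Nat.factorial (j + (k + 1 + 1)) : ℝ)) * 1) := by gcongr
        _ ≤ _ := by
          rw [mul_one, mul_one_div, div_le_div_iff₀ (by positivity) (by positivity), one_mul]
          exact c)
    rw [Real.norm_eq_abs] at this
    linarith

open Equiv in
lemma jm_fiber {n : ℕ} [NeZero n] (i c : ZMod n) (F : Perm (ZMod n) → ℝ) :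
    (n : ℝ) * ∑ σ : Perm (ZMod n), (if σ i = c then F σ else 0) =
      ∑ σ : Perm (ZMod n), F (swap (σ i) c * σ) := by
  have h1 : ∑ σ : Perm (ZMod n), F (swap (σ i) c * σ) =
      ∑ d : ZMod n, ∑ σ : Perm (ZMod n), (if σ i = d then F (swap d c * σ) else 0) := by
    rw [Finset.sum_comm]
    refine Finset.sum_congr rfl (fun σ _ => ?_)
    simp
  have h2 : ∀ d : ZMod n, ∑ σ : Perm (ZMod n), (if σ i = d then F (swap d c * σ) else 0) =
      ∑ σ : Perm (ZMod n), (if σ i = c then F σ else 0) := by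
    intro d
    refine Fintype.sum_equiv (Equiv.mulLeft (swap d c)) _ _ (fun σ => ?_)
    have : swap d c (σ i) = c ↔ σ i = d := by
      rw [← Equiv.eq_symm_apply]; simp
    simp [this]
  rw [h1, Finset.sum_congr rfl (fun d _ => h2 d)]
  simp [ZMod.card]

open Equiv in
lemma jm_count1 {n : ℕ} [NeZero n] (i c : ZMod n) :
    (n : ℝ) * ∑ σ : Perm (ZMod n), (if σ i = c then (1:ℝ) else 0) = n.factorial := by
  rw [jm_fiber i c (fun _ => 1)]
  simp [Fintype.card_perm, ZMod.card]

open Equiv in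
lemma jm_count2 {n : ℕ} [NeZero n] (b i d : ZMod n) (hb : b ≠ i) (hd : d ≠ i) :
    ((n : ℝ) - 1) * ∑ σ : Perm (ZMod n), (if σ b = i ∧ σ i = d then (1:ℝ) else 0) =
      ∑ σ : Perm (ZMod n), (if σ b = i then (1:ℝ) else 0) := by
  have h2 : ∀ c ∈ Finset.univ.erase i, ∑ σ : Perm (ZMod n), (if σ b = i ∧ σ i = c then (1:ℝ) else 0) =
      ∑ σ : Perm (ZMod n), (if σ b = i ∧ σ i = d then (1:ℝ) else 0) := by
    intro c hc
    have hc : c ≠ i := by simpa using hc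
    refine Fintype.sum_equiv (Equiv.mulLeft (swap c d)) _ _ (fun σ => ?_)
    have e1 : swap c d (σ i) = d ↔ σ i = c := by
      rw [← Equiv.eq_symm_apply]; simp
    have e2 : swap c d (σ b) = i ↔ σ b = i := by
      rw [← Equiv.eq_symm_apply]; simp [swap_apply_of_ne_of_ne hc.symm hd.symm]
    simp [e1, e2]
  have h3 := Finset.sum_congr rfl h2
  rw [Finset.sum_comm] at h3
  have hn : 1 ≤ n := NeZero.one_le
  rw [Finset.sum_const, Finset.card_erase_of_mem (Finset.mem_univ _), Finset.card_univ, ZMod.card,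
    nsmul_eq_mul, Nat.cast_sub hn, Nat.cast_one] at h3
  rw [← h3]
  refine Finset.sum_congr rfl (fun σ _ => ?_)
  by_cases h : σ b = i
  · have : σ i ≠ i := fun h' => hb (σ.injective (h.trans h'.symm))
    simp [h, this]
  · simp [h]

open Equiv in
lemma jm_count3 {n : ℕ} [NeZero n] (b d : ZMod n) :
    (n : ℝ) * ∑ σ : Perm (ZMod n), (if σ b ≠ b ∧ σ b ≠ d ∧ σ (σ b) = d then (1:ℝ) else 0) ≤ n.factorial := by
  have h1 : ∑ σ : Perm (ZMod n), (if σ b ≠ b ∧ σ b ≠ d ∧ σ (σ b) = d then (1:ℝ) else 0) ≤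
    ∑ i ∈ Finset.univ.erase b, ∑ σ : Perm (ZMod n), (if i ≠ d ∧ σ b = i ∧ σ i = d then (1:ℝ) else 0) := by
    rw [Finset.sum_comm]
    refine Finset.sum_le_sum (fun σ _ => ?_)
    split_ifs with h
    · refine le_trans ?_ (Finset.single_le_sum (a := σ b) (fun i _ => by positivity) (by simpa using h.1))
      simp [h.2.1, h.2.2]
    · exact Finset.sum_nonneg (fun i _ => by positivity)
  have hn : 1 ≤ n := NeZero.one_le
  rcases hn.eq_or_lt with h | h
  · subst h
    have : ∀ σ : Perm (ZMod 1), σ b = b := fun σ => Subsingleton.elim _ _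
    simp [this]
  have hn1 : (0:ℝ) < n - 1 := by
    have : (1:ℝ) < n := by exact_mod_cast h
    linarith
  have h2 : ∀ i ∈ Finset.univ.erase b, (n:ℝ) * ∑ σ : Perm (ZMod n), (if i ≠ d ∧ σ b = i ∧ σ i = d then (1:ℝ) else 0) ≤ n.factorial / (n - 1) := by
    intro i hi
    have hi : i ≠ b := by simpa using hi
    by_cases hd : i = d
    · simp [hd]; positivity
    · have := jm_count2 b i d hi.symm (Ne.symm hd)
      have t := jm_count1 b i
      rw [← this] at t
      simp only [ne_eq, hd, not_false_eq_true, true_and]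
      rw [le_div_iff₀ hn1]
      linarith
  calc _ ≤ (n:ℝ) * ∑ i ∈ Finset.univ.erase b, ∑ σ : Perm (ZMod n), (if i ≠ d ∧ σ b = i ∧ σ i = d then (1:ℝ) else 0) := by gcongr
    _ ≤ ∑ i ∈ Finset.univ.erase b, (n.factorial / (n - 1) : ℝ) := by
      rw [Finset.mul_sum]; exact Finset.sum_le_sum h2
    _ = _ := by
      rw [Finset.sum_const, Finset.card_erase_of_mem (Finset.mem_univ _), Finset.card_univ, ZMod.card,
    nsmul_eq_mul, Nat.cast_sub hn, Nat.cast_one]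
      field_simp

/-- fixed points -/
def jmW1 {n : ℕ} [NeZero n] (σ : Equiv.Perm (ZMod n)) : ℕ := (Finset.univ.filter fun i : ZMod n => σ i = i).card
/-- shifts -/
def jmW2 {n : ℕ} [NeZero n] (σ : Equiv.Perm (ZMod n)) : ℕ := (Finset.univ.filter fun i : ZMod n => σ i = i + 1).card

open Equiv in
lemma jm_core {n : ℕ} [NeZero n] (V : Perm (ZMod n) → ℕ) (bad : Perm (ZMod n) → ZMod n → ℝ)
    (hgood : ∀ σ i, (jmW1 (swap (σ i) i * σ) = jmW1 σ + 1 ∧ V (swap (σ i) i * σ) = V σ) ∨ 1 ≤ bad σ i)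
    (hb : ∀ σ i, 0 ≤ bad σ i)
    (f : ℕ → ℕ → ℝ) (C : ℝ) (hf : ∀ j k, |f (j+1) k| ≤ C) :
    n * |∑ σ : Perm (ZMod n), (f (jmW1 σ + 1) (V σ) - jmW1 σ * f (jmW1 σ) (V σ))| ≤
      2 * C * ∑ i, ∑ σ, bad σ i := by
  have hC : 0 ≤ C := (abs_nonneg _).trans (hf 0 0)
  have h1 : (n:ℝ) * ∑ σ : Perm (ZMod n), (jmW1 σ * f (jmW1 σ) (V σ)) =
      ∑ i, ∑ σ : Perm (ZMod n), f (jmW1 (swap (σ i) i * σ)) (V (swap (σ i) i * σ)) := by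
    rw [← Finset.sum_congr rfl (fun i _ => jm_fiber i i (fun σ => f (jmW1 σ) (V σ))), ← Finset.mul_sum,
      Finset.sum_comm]
    congr 1
    refine Finset.sum_congr rfl (fun σ _ => ?_)
    rw [← Finset.sum_filter, Finset.sum_const, nsmul_eq_mul]; rfl
  have h2 : (n:ℝ) * ∑ σ : Perm (ZMod n), f (jmW1 σ + 1) (V σ) = ∑ _i : ZMod n, ∑ σ : Perm (ZMod n), f (jmW1 σ + 1) (V σ) := by
    simp [ZMod.card]
  have hn : |(n:ℝ)| = n := abs_of_nonneg (by positivity)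
  conv_lhs => rw [← hn, ← abs_mul, Finset.sum_sub_distrib, mul_sub, h1, h2, ← Finset.sum_sub_distrib]
  rw [Finset.mul_sum]
  refine (Finset.abs_sum_le_sum_abs _ _).trans (Finset.sum_le_sum fun i _ => ?_)
  rw [← Finset.sum_sub_distrib, Finset.mul_sum]
  refine (Finset.abs_sum_le_sum_abs _ _).trans (Finset.sum_le_sum fun σ _ => ?_)
  rcases hgood σ i with h | h
  · rw [h.1, h.2]; simp; exact mul_nonneg (by linarith) (hb σ i)
  · have hp : ∃ m, jmW1 (swap (σ i) i * σ) = m + 1 := by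
      refine Nat.exists_eq_succ_of_ne_zero (Finset.card_ne_zero_of_mem (a := i) ?_)
      rw [Finset.mem_filter]; simp
    obtain ⟨m, hm⟩ := hp
    rw [hm]
    have := abs_sub (f (jmW1 σ + 1) (V σ)) (f (m+1) (V (swap (σ i) i * σ)))
    have a := hf (jmW1 σ) (V σ)
    have b := hf m (V (swap (σ i) i * σ))
    nlinarith

open Equiv in
lemma jm_good1 {n : ℕ} [NeZero n] (σ : Perm (ZMod n)) (i : ZMod n) (h1 : σ i ≠ i) (h2 : σ (σ i) ≠ i) :
    jmW1 (swap (σ i) i * σ) = jmW1 σ + 1 := by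
  have : (Finset.univ.filter fun x : ZMod n => (swap (σ i) i * σ) x = x) =
      insert i (Finset.univ.filter fun x : ZMod n => σ x = x) := by
    ext x
    rw [Finset.mem_insert, Finset.mem_filter, Finset.mem_filter]
    simp only [Finset.mem_univ, true_and, Perm.mul_apply]
    by_cases hx : x = i
    · simp [hx]
    · have : σ x ≠ σ i := fun h => hx (σ.injective h)
      by_cases hb : σ x = i
      · rw [hb, swap_apply_right]
        constructor
        · intro h; rw [h] at h2; exact absurd hb h2
        · rintro (h | h)
          · exact absurd h hx
          · exact absurd h.symm hx
      · rw [swap_apply_of_ne_of_ne this hb]; simp [hx]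
  unfold jmW1
  rw [this, Finset.card_insert_of_notMem (by simpa using h1)]

open Equiv in
lemma jm_good2 {n : ℕ} [NeZero n] (σ : Perm (ZMod n)) (i : ZMod n) (h1 : σ i ≠ i)
    (h3 : σ i ≠ i + 1) (h4 : σ (i - 1) ≠ i) (h5 : σ i ≠ σ.symm i + 1) :
    jmW2 (swap (σ i) i * σ) = jmW2 σ := by
  unfold jmW2
  congr 1
  ext x
  rw [Finset.mem_filter, Finset.mem_filter]
  simp only [Finset.mem_univ, true_and, Perm.mul_apply]
  by_cases hx : x = i
  · subst hx
    have : x ≠ x + 1 := by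
      intro h
      have h10 : (1 : ZMod n) = 0 := by simpa using h.symm
      exact h1 (by have := congrArg (· * (σ x - x)) h10; simpa [sub_eq_zero] using this)
    simp [this, h3]
  · have : σ x ≠ σ i := fun h => hx (σ.injective h)
    by_cases hb : σ x = i
    · rw [hb, swap_apply_right]
      have hbx : σ.symm i = x := by rw [← hb]; simp
      rw [hbx] at h5
      simp only [h5, false_iff]
      intro h
      apply h4
      rw [h]; simp; rw [hb, h]
    · rw [swap_apply_of_ne_of_ne this hb]

open Equiv in
lemma jm_part1 {n : ℕ} [NeZero n] (f : ℕ → ℕ → ℝ) (C : ℝ) (hf : ∀ j k, |f (j+1) k| ≤ C) :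
    n * |∑ σ : Perm (ZMod n), (f (jmW1 σ + 1) (jmW2 σ) - jmW1 σ * f (jmW1 σ) (jmW2 σ))| ≤
      10 * C * n.factorial := by
  have hC : 0 ≤ C := (abs_nonneg _).trans (hf 0 0)
  have key := jm_core (n := n) jmW2 (fun σ i => (if σ i = i then (1:ℝ) else 0) +
    (if σ i ≠ i ∧ σ i ≠ i ∧ σ (σ i) = i then (1:ℝ) else 0) +
    (if σ i = i + 1 then (1:ℝ) else 0) + (if σ (i - 1) = i then (1:ℝ) else 0) +
    (if σ i ≠ i ∧ σ i = σ.symm i + 1 then (1:ℝ) else 0)) ?_ (fun σ i => by positivity) f C hf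
  · refine key.trans ?_
    have hn : (0:ℝ) < n := by exact_mod_cast NeZero.pos n
    have hN : ∑ _i : ZMod n, ((n.factorial : ℝ) / n) = n.factorial := by
      simp [ZMod.card]; field_simp
    have s1 : ∀ c : ZMod n → ZMod n, ∀ d : ZMod n → ZMod n, ∑ i : ZMod n, ∑ σ : Perm (ZMod n), (if σ (d i) = c i then (1:ℝ) else 0) ≤ n.factorial := by
      intro c d
      rw [← hN]
      refine Finset.sum_le_sum (fun i _ => ?_)
      rw [le_div_iff₀ hn, mul_comm]
      exact (jm_count1 _ _).le
    have s2 : ∀ d : ZMod n → ZMod n, ∑ b : ZMod n, ∑ σ : Perm (ZMod n), (if σ b ≠ b ∧ σ b ≠ d b ∧ σ (σ b) = d b then (1:ℝ) else 0) ≤ n.factorial := by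
      intro d
      rw [← hN]
      refine Finset.sum_le_sum (fun i _ => ?_)
      rw [le_div_iff₀ hn, mul_comm]
      exact jm_count3 _ _
    have s5 : ∑ i : ZMod n, ∑ σ : Perm (ZMod n), (if σ i ≠ i ∧ σ i = σ.symm i + 1 then (1:ℝ) else 0) ≤ n.factorial := by
      refine le_trans (le_of_eq ?_) (s2 (fun b => b + 1))
      rw [Finset.sum_comm]
      conv_rhs => rw [Finset.sum_comm]
      refine Finset.sum_congr rfl (fun σ _ => ?_)
      refine Fintype.sum_equiv σ.symm _ _ (fun i => ?_)
      congr 1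
      simp only [Equiv.apply_symm_apply, eq_iff_iff]
      constructor
      · rintro ⟨a, b⟩
        refine ⟨fun h => a ?_, fun h => a ?_, b⟩
        · conv_lhs => rw [h]
          simp
        · rw [b, ← h]
      · rintro ⟨a, b, c⟩
        exact ⟨fun h => b (by rw [← c, h]), c⟩
    simp only [Finset.sum_add_distrib]
    have t1 := s1 id id
    have t2 := s2 id
    have t3 := s1 (fun i => i + 1) id
    have t4 := s1 id (fun i => i - 1)
    simp only [id] at t1 t2 t3 t4
    nlinarith
  · intro σ i
    by_cases h1 : σ i = i
    · right; rw [if_pos h1]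
      have : ∀ a b c d : ℝ, 0 ≤ a → 0 ≤ b → 0 ≤ c → 0 ≤ d → 1 ≤ 1 + a + b + c + d := by intros; linarith
      apply this <;> positivity
    by_cases h2 : σ (σ i) = i
    · right; rw [if_pos (⟨h1, h1, h2⟩ : σ i ≠ i ∧ σ i ≠ i ∧ σ (σ i) = i)]
      have : ∀ a b c d : ℝ, 0 ≤ a → 0 ≤ b → 0 ≤ c → 0 ≤ d → 1 ≤ a + 1 + b + c + d := by intros; linarith
      apply this <;> positivity
    by_cases h3 : σ i = i + 1
    · right; rw [if_pos h3]
      have : ∀ a b c d : ℝ, 0 ≤ a → 0 ≤ b → 0 ≤ c → 0 ≤ d → 1 ≤ a + b + 1 + c + d := by intros; linarith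
      apply this <;> positivity
    by_cases h4 : σ (i - 1) = i
    · right; rw [if_pos h4]
      have : ∀ a b c d : ℝ, 0 ≤ a → 0 ≤ b → 0 ≤ c → 0 ≤ d → 1 ≤ a + b + c + 1 + d := by intros; linarith
      apply this <;> positivity
    by_cases h5 : σ i = σ.symm i + 1
    · right; rw [if_pos (⟨h1, h5⟩ : σ i ≠ i ∧ σ i = σ.symm i + 1)]
      have : ∀ a b c d : ℝ, 0 ≤ a → 0 ≤ b → 0 ≤ c → 0 ≤ d → 1 ≤ a + b + c + d + 1 := by intros; linarith
      apply this <;> positivity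
    left
    exact ⟨jm_good1 σ i h1 h2, jm_good2 σ i h1 h3 h4 h5⟩

open Equiv in
lemma jm_part2 {n : ℕ} [NeZero n] (f : ℕ → ℝ) (C : ℝ) (hf : ∀ j, |f (j+1)| ≤ C) :
    n * |∑ σ : Perm (ZMod n), (f (jmW2 σ + 1) - jmW2 σ * f (jmW2 σ))| ≤
      4 * C * n.factorial := by
  have hC : 0 ≤ C := (abs_nonneg _).trans (hf 0)
  have e : ∑ σ : Perm (ZMod n), (f (jmW2 σ + 1) - jmW2 σ * f (jmW2 σ)) =
      ∑ σ : Perm (ZMod n), (f (jmW1 σ + 1) - jmW1 σ * f (jmW1 σ)) := by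
    refine Fintype.sum_equiv (Equiv.mulLeft (Equiv.subRight (1 : ZMod n))) _ _ (fun σ => ?_)
    have : jmW1 (Equiv.mulLeft (Equiv.subRight (1 : ZMod n)) σ) = jmW2 σ := by
      unfold jmW1 jmW2
      congr 1
      ext x
      simp [sub_eq_iff_eq_add]
    rw [this]
  rw [e]
  have key := jm_core (n := n) (fun _ => 0) (fun σ i => (if σ i = i then (1:ℝ) else 0) +
    (if σ i ≠ i ∧ σ i ≠ i ∧ σ (σ i) = i then (1:ℝ) else 0)) ?_ (fun σ i => by positivity) (fun j _ => f j) C (fun j _ => hf j)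
  · refine key.trans ?_
    have hn : (0:ℝ) < n := by exact_mod_cast NeZero.pos n
    have hN : ∑ _i : ZMod n, ((n.factorial : ℝ) / n) = n.factorial := by
      simp [ZMod.card]; field_simp
    have s1 : ∑ i : ZMod n, ∑ σ : Perm (ZMod n), (if σ i = i then (1:ℝ) else 0) ≤ n.factorial := by
      rw [← hN]
      refine Finset.sum_le_sum (fun i _ => ?_)
      rw [le_div_iff₀ hn, mul_comm]
      exact (jm_count1 _ _).le
    have s2 : ∑ b : ZMod n, ∑ σ : Perm (ZMod n), (if σ b ≠ b ∧ σ b ≠ b ∧ σ (σ b) = b then (1:ℝ) else 0) ≤ n.factorial := by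
      rw [← hN]
      refine Finset.sum_le_sum (fun i _ => ?_)
      rw [le_div_iff₀ hn, mul_comm]
      exact jm_count3 _ _
    simp only [Finset.sum_add_distrib]
    nlinarith
  · intro σ i
    by_cases h1 : σ i = i
    · right; simp [h1]
    by_cases h2 : σ (σ i) = i
    · right; simp [h1, h2]
    left
    exact ⟨jm_good1 σ i h1 h2, rfl⟩

lemma jm_lint (g : ℕ → ℝ) (h0 : ∀ k, 0 ≤ g k) (h1 : ∀ k, g k ≤ 1) :
    ∫⁻ k, ENNReal.ofReal (g k) ∂(poissonMeasure 1) =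
      ENNReal.ofReal (∑' j : ℕ, Real.exp (-1) * ((1 / (Nat.factorial j : ℝ)) * g j)) := by
  have hs := (jm_summ g (fun k => abs_le.2 ⟨by linarith [h0 k], h1 k⟩)).mul_left (Real.exp (-1))
  rw [ENNReal.ofReal_tsum_of_nonneg (fun j => mul_nonneg (Real.exp_pos _).le (mul_nonneg (by positivity) (h0 j))) hs]
  unfold poissonMeasure
  rw [lintegral_sum_measure]
  congr 1
  ext j
  rw [lintegral_smul_measure, lintegral_dirac, smul_eq_mul, ← ENNReal.ofReal_mul (by positivity)]
  congr 1
  simp; ring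

instance jm_prob : IsProbabilityMeasure (poissonMeasure 1) := by
  constructor
  have := jm_lint (fun _ => 1) (by simp) (by simp)
  simp only [ENNReal.ofReal_one, lintegral_const, one_mul, mul_one] at this
  rw [this, tsum_mul_left, jm_exp.tsum_eq, ← Real.exp_add]
  simp

lemma jm_mean01 (g : ℕ → ℝ) (h0 : ∀ k, 0 ≤ g k) (h1 : ∀ k, g k ≤ 1) :
    0 ≤ (∑' j : ℕ, Real.exp (-1) * ((1 / (Nat.factorial j : ℝ)) * g j)) ∧
    (∑' j : ℕ, Real.exp (-1) * ((1 / (Nat.factorial j : ℝ)) * g j)) ≤ 1 := by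
  have hs := (jm_summ g (fun k => abs_le.2 ⟨by linarith [h0 k], h1 k⟩)).mul_left (Real.exp (-1))
  refine ⟨tsum_nonneg (fun j => mul_nonneg (Real.exp_pos _).le (mul_nonneg (by positivity) (h0 j))), ?_⟩
  have h : ∑' j : ℕ, Real.exp (-1) * (1 / (Nat.factorial j : ℝ)) = 1 := by
    rw [tsum_mul_left, jm_exp.tsum_eq, ← Real.exp_add]; simp
  refine le_trans ?_ h.le
  refine hs.tsum_le_tsum (fun j => ?_) (jm_exp.summable.mul_left _)
  have := h1 j
  gcongr
  exact mul_le_of_le_one_right (by positivity) this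

open Classical in
lemma jm_prod (A : Set (ℕ × ℕ)) :
    (((poissonMeasure 1).prod (poissonMeasure 1)) A).toReal =
    ∑' k : ℕ, Real.exp (-1) * ((1 / (Nat.factorial k : ℝ)) *
      ∑' j : ℕ, Real.exp (-1) * ((1 / (Nat.factorial j : ℝ)) * (if (j, k) ∈ A then 1 else 0))) := by
  have hh0 : ∀ j k : ℕ, (0:ℝ) ≤ (if (j, k) ∈ A then 1 else 0) := fun j k => by positivity
  have hh1 : ∀ j k : ℕ, (if (j, k) ∈ A then (1:ℝ) else 0) ≤ 1 := fun j k => by split_ifs <;> norm_num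
  rw [Measure.prod_apply_symm (Set.to_countable A).measurableSet]
  have : ∀ k : ℕ, poissonMeasure 1 ((fun x => (x, k)) ⁻¹' A) = ENNReal.ofReal
      (∑' j : ℕ, Real.exp (-1) * ((1 / (Nat.factorial j : ℝ)) * (if (j, k) ∈ A then 1 else 0))) := by
    intro k
    rw [← jm_lint _ (fun j => hh0 j k) (fun j => hh1 j k), ← lintegral_indicator_one (Set.to_countable _).measurableSet]
    congr 1
    ext j
    by_cases h : (j, k) ∈ A <;> simp [h, Set.indicator]
  simp_rw [this]
  rw [jm_lint _ (fun k => (jm_mean01 _ (fun j => hh0 j k) (fun j => hh1 j k)).1)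
    (fun k => (jm_mean01 _ (fun j => hh0 j k) (fun j => hh1 j k)).2), ENNReal.toReal_ofReal]
  exact (jm_mean01 _ (fun k => (jm_mean01 _ (fun j => hh0 j k) (fun j => hh1 j k)).1)
    (fun k => (jm_mean01 _ (fun j => hh0 j k) (fun j => hh1 j k)).2)).1

open Classical in
lemma jm_unif (n : ℕ) [NeZero n] (A : Set (ℕ × ℕ)) :
    (((uniformPermZ n).map (fun σ => (jmW1 σ, jmW2 σ))) A).toReal =
    (n.factorial : ℝ)⁻¹ * ∑ σ : Equiv.Perm (ZMod n), (if (jmW1 σ, jmW2 σ) ∈ A then (1:ℝ) else 0) := by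
  have hm : Measurable (fun σ : Equiv.Perm (ZMod n) => (jmW1 σ, jmW2 σ)) := measurable_from_top
  rw [Measure.map_apply hm (Set.to_countable A).measurableSet]
  have : MeasurableSingletonClass (Equiv.Perm (ZMod n)) := ⟨fun _ => MeasurableSpace.measurableSet_top⟩
  unfold uniformPermZ
  rw [Measure.smul_apply, smul_eq_mul, ENNReal.toReal_mul]
  congr 1
  · simp [Fintype.card_perm, ZMod.card]
  · rw [Measure.count_apply_finite _ (Set.toFinite _)]
    rw [← Finset.sum_filter, Finset.sum_const, nsmul_eq_mul, mul_one]
    simp only [ENNReal.toReal_natCast, Nat.cast_inj]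
    congr 1
    ext σ
    simp

theorem joint_matching_poisson_approx (n : ℕ) [NeZero n] :
    ∀ A : Set (ℕ × ℕ),
      |(((uniformPermZ n).map (fun σ =>
          ((Finset.univ.filter fun i : ZMod n => σ i = i).card,
           (Finset.univ.filter fun i : ZMod n => σ i = i + 1).card))) A).toReal -
        (((poissonMeasure 1).prod (poissonMeasure 1)) A).toReal| ≤ 13 / n := by
  classical
  intro A
  have hu := jm_unif n A
  unfold jmW1 jmW2 at hu
  rw [hu, jm_prod]
  change |(n.factorial : ℝ)⁻¹ * ∑ σ : Equiv.Perm (ZMod n), (if (jmW1 σ, jmW2 σ) ∈ A then (1:ℝ) else 0) - _| ≤ _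
  have hh0 : ∀ j k : ℕ, (0:ℝ) ≤ (if (j, k) ∈ A then 1 else 0) := fun j k => by positivity
  have hh1 : ∀ j k : ℕ, (if (j, k) ∈ A then (1:ℝ) else 0) ≤ 1 := fun j k => by split_ifs <;> norm_num
  have hG := fun k => jm_mean01 _ (fun j => hh0 j k) (fun j => hh1 j k)
  choose f1 hf1 hf1b using fun k => jm_stein _ (fun j => hh0 j k) (fun j => hh1 j k)
  obtain ⟨f2, hf2, hf2b⟩ := jm_stein _ (fun k => (hG k).1) (fun k => (hG k).2)
  have p1 := jm_part1 (n := n) (fun j k => f1 k j) (9/10) (fun j k => hf1b k j)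
  have p2 := jm_part2 (n := n) f2 (9/10) hf2b
  simp only [hf1] at p1
  simp only [hf2] at p2
  set P := ∑' k : ℕ, Real.exp (-1) * ((1 / (Nat.factorial k : ℝ)) *
      ∑' j : ℕ, Real.exp (-1) * ((1 / (Nat.factorial j : ℝ)) * (if (j, k) ∈ A then 1 else 0))) with hP
  have hn : (0:ℝ) < n := by exact_mod_cast NeZero.pos n
  have hN : (0:ℝ) < n.factorial := by positivity
  rw [Finset.sum_sub_distrib] at p1 p2
  have hc : ∑ _σ : Equiv.Perm (ZMod n), P = n.factorial * P := by
    simp [Fintype.card_perm, ZMod.card]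
  rw [hc] at p2
  set S1 := ∑ σ : Equiv.Perm (ZMod n), (if (jmW1 σ, jmW2 σ) ∈ A then (1:ℝ) else 0)
  have tri := abs_sub_le S1 (∑ σ : Equiv.Perm (ZMod n), ∑' j : ℕ, Real.exp (-1) * ((1 / (Nat.factorial j : ℝ)) * (if (j, jmW2 σ) ∈ A then 1 else 0))) (n.factorial * P)
  have e : (n.factorial : ℝ)⁻¹ * S1 - P = (n.factorial : ℝ)⁻¹ * (S1 - n.factorial * P) := by
    field_simp
  rw [e, abs_mul, abs_of_pos (by positivity), inv_mul_le_iff₀ hN, mul_div_assoc', le_div_iff₀ hn]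
  have tri2 := mul_le_mul_of_nonneg_left tri hn.le
  nlinarith
end

section
/- Let n ≥ 2, let σ be a uniformly random permutation of {1, …, n}, and for 1 ≤ i ≤ n let X_i = 1 if σ(i) = i and X_i = 0 otherwise. Let Y_1, …, Y_n be independent Poisson random variables, each with mean 1/n. Then the total variation distance between the law of the vector (X_1, …, X_n) and the law of (Y_1, …, Y_n), as probability measures on ℕ^n, is at most 4/n. -/
open MeasureTheory

instance (n : ℕ) : MeasurableSpace (Equiv.Perm (Fin n)) := ⊤

/-- The uniform distribution on the permutations of `{1, …, n}`. -/
noncomputable def uniformPerm (n : ℕ) : Measure (Equiv.Perm (Fin n)) :=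
  (Fintype.card (Equiv.Perm (Fin n)) : ENNReal)⁻¹ • Measure.count

open MeasureTheory Finset

lemma aux_numDer (m : ℕ) : (numDerangements m : ℝ) =
    m.factorial * ∑ i ∈ range (m + 1), (-1 : ℝ) ^ i * (1 / (i.factorial : ℝ)) := by
  induction m with
  | zero => simp
  | succ m ih =>
    have h := numDerangements_succ m
    have h' : (numDerangements (m + 1) : ℝ) = (m + 1) * (numDerangements m : ℝ) - (-1) ^ m := by
      exact_mod_cast h
    rw [h', ih, Finset.sum_range_succ _ (m + 1), Nat.factorial_succ]
    have := Nat.factorial_pos m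
    push_cast
    field_simp
    ring

lemma aux_alt (m : ℕ) : ∑ i ∈ range (m + 1), (-1 : ℝ) ^ i * (1 / (i.factorial : ℝ)) ≤
    Real.exp (-1) + 1 / ((m + 1).factorial : ℝ) := by
  have hs : HasSum (fun i : ℕ => (-1 : ℝ) ^ i * (1 / (i.factorial : ℝ))) (Real.exp (-1)) := by
    have := NormedSpace.expSeries_div_hasSum_exp (-1 : ℝ)
    rw [← Real.exp_eq_exp_ℝ] at this
    simpa [div_eq_mul_inv] using this
  have ht := hs.tendsto_sum_nat
  have ha : Antitone (fun i : ℕ => 1 / (i.factorial : ℝ)) := by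
    intro a b hab
    apply one_div_le_one_div_of_le
    · exact_mod_cast Nat.factorial_pos a
    · exact_mod_cast Nat.factorial_le hab
  have key := ha.alternating_series_le_tendsto ht
  have hp : 0 ≤ 1 / ((m + 1).factorial : ℝ) := by positivity
  rcases Nat.even_or_odd' m with ⟨k, hk | hk⟩
  · have h := key (k + 1)
    rw [show 2 * (k + 1) = (m + 1) + 1 by omega, Finset.sum_range_succ] at h
    rw [show (-1 : ℝ) ^ (m + 1) = -1 by rw [hk]; simp [pow_succ]] at h
    linarith
  · have h := key (k + 1)
    rw [show 2 * (k + 1) = (m + 1) by omega] at h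
    linarith

lemma aux_desc (n : ℕ) (hn : 2 ≤ n) (k : ℕ) (hk : k ≤ n) :
    (n : ℝ) ^ k * (1 - k * (k - 1) / (2 * n)) ≤ (n.descFactorial k : ℝ) := by
  induction k with
  | zero => simp
  | succ k ih =>
    have ih := ih (by omega)
    have hn0 : (0 : ℝ) < n := by positivity
    have hkn : (k : ℝ) + 1 ≤ n := by exact_mod_cast hk
    rw [Nat.descFactorial_succ]
    push_cast [Nat.cast_sub (show k ≤ n by omega)]
    have h1 : ((n : ℝ) - k) * ((n : ℝ) ^ k * (1 - k * (k - 1) / (2 * n))) ≤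
        (n - k) * (n.descFactorial k : ℝ) := mul_le_mul_of_nonneg_left ih (by linarith)
    refine le_trans ?_ h1
    have hkk : (0 : ℝ) ≤ (k : ℝ) * (k - 1) := by
      rcases Nat.eq_zero_or_pos k with h | h
      · simp [h]
      · have : (1 : ℝ) ≤ k := by exact_mod_cast h
        nlinarith
    have h2 : ((n : ℝ) - k) * ((n : ℝ) ^ k * (1 - k * (k - 1) / (2 * n))) -
      (n : ℝ) ^ (k + 1) * (1 - (k + 1) * (k + 1 - 1) / (2 * n)) =
        (n : ℝ) ^ k * (k * (k * (k - 1)) / (2 * n)) := by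
      field_simp
      ring
    have h3 : 0 ≤ (n : ℝ) ^ k * (k * (k * (k - 1)) / (2 * n)) := by positivity
    linarith

/-- The pointwise error. -/
noncomputable def auxC (n k : ℕ) : ℝ :=
  ((n - k).factorial : ℝ) / n.factorial *
    (Real.exp (-1) * (k * (k - 1)) / (2 * n) + 1 / ((n - k + 1).factorial : ℝ))

lemma auxC_nonneg (n k : ℕ) : 0 ≤ auxC n k := by
  have hkk : (0 : ℝ) ≤ (k : ℝ) * (k - 1) := by
    rcases Nat.eq_zero_or_pos k with h | h
    · simp [h]
    · have : (1 : ℝ) ≤ k := by exact_mod_cast h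
      nlinarith
  unfold auxC
  positivity

lemma aux_point (n : ℕ) (hn : 2 ≤ n) (k : ℕ) (hk : k ≤ n) :
    (numDerangements (n - k) : ℝ) / n.factorial ≤
      Real.exp (-1) * (1 / n) ^ k + auxC n k := by
  have hn0 : (0 : ℝ) < n := by positivity
  have hf : (0 : ℝ) < n.factorial := by positivity
  have hm : (0 : ℝ) < (n - k).factorial := by positivity
  have he := Real.exp_pos (-1)
  have h1 := aux_desc n hn k hk
  have h2 : ((n - k).factorial : ℝ) * n.descFactorial k = n.factorial := by
    exact_mod_cast Nat.factorial_mul_descFactorial hk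
  have h3 : ((n - k).factorial : ℝ) / n.factorial * (1 - k * (k - 1) / (2 * n)) ≤ (1 / n) ^ k := by
    rw [one_div_pow, le_div_iff₀ (by positivity), div_mul_eq_mul_div, div_mul_eq_mul_div,
      div_le_one hf, ← h2]
    nlinarith
  have h4 := aux_alt (n - k)
  rw [aux_numDer]
  have h5 : ((n - k).factorial : ℝ) / n.factorial *
    (∑ i ∈ range (n - k + 1), (-1 : ℝ) ^ i * (1 / (i.factorial : ℝ))) ≤
    ((n - k).factorial : ℝ) / n.factorial * (Real.exp (-1) + 1 / ((n - k + 1).factorial : ℝ)) :=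
    mul_le_mul_of_nonneg_left h4 (by positivity)
  have h6 := mul_le_mul_of_nonneg_left h3 he.le
  rw [mul_div_right_comm]
  refine h5.trans ?_
  unfold auxC
  have : Real.exp (-1) * (((n - k).factorial : ℝ) / n.factorial * (1 - k * (k - 1) / (2 * n))) +
    ((n - k).factorial : ℝ) / n.factorial *
    (Real.exp (-1) * (k * (k - 1)) / (2 * n) + 1 / ((n - k + 1).factorial : ℝ)) =
    ((n - k).factorial : ℝ) / n.factorial * (Real.exp (-1) + 1 / ((n - k + 1).factorial : ℝ)) := by
    ring
  linarith

lemma aux_sum1 (N : ℕ) : ∑ k ∈ range (N + 2), ((k : ℝ) * (k - 1)) / k.factorial ≤ Real.exp 1 := by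
  have h : ∑ k ∈ range (N + 2), ((k : ℝ) * (k - 1)) / k.factorial =
      ∑ k ∈ range N, (1 : ℝ) ^ k / k.factorial := by
    rw [Finset.sum_range_succ', Finset.sum_range_succ']
    simp only [Nat.cast_zero, zero_mul, zero_div, add_zero, Nat.cast_add, Nat.cast_one, zero_add,
      sub_self, mul_zero]
    refine Finset.sum_congr rfl fun k _ => ?_
    rw [Nat.factorial_succ, Nat.factorial_succ]
    have := Nat.factorial_pos k
    push_cast
    rw [one_pow]
    field_simp
    ring
  rw [h]
  exact Real.sum_le_exp_of_nonneg (by norm_num) N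

lemma aux_pow (n : ℕ) (hn : 2 ≤ n) : 2 * n * 2 ^ (n + 1) ≤ 7 * (n + 1).factorial := by
  induction n, hn using Nat.le_induction with
  | base => decide
  | succ n hn ih =>
    rw [Nat.factorial_succ (n + 1), pow_succ]
    have : 2 * (n + 1) * (2 ^ (n + 1) * 2) ≤ (n + 2) * (2 * n * 2 ^ (n + 1)) := by
      have h : 2 * (n + 1) * 2 ≤ (n + 2) * (2 * n) := by nlinarith
      have := Nat.mul_le_mul_right (2 ^ (n + 1)) h
      nlinarith
    nlinarith

lemma aux_sum2 (n : ℕ) :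
    ∑ k ∈ range (n + 1), 1 / ((k.factorial : ℝ) * (n - k + 1).factorial) ≤
      2 ^ (n + 1) / (n + 1).factorial := by
  have h : ∀ k ∈ range (n + 1), 1 / ((k.factorial : ℝ) * (n - k + 1).factorial) =
      ((n + 1).choose k : ℝ) / (n + 1).factorial := by
    intro k hk
    have hk' : k ≤ n := by simpa [Nat.lt_succ_iff] using hk
    have := Nat.choose_mul_factorial_mul_factorial (show k ≤ n + 1 by omega)
    rw [show n + 1 - k = n - k + 1 by omega] at this
    rw [← this]
    have hc : 0 < (n + 1).choose k := Nat.choose_pos (by omega)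
    push_cast
    field_simp
  rw [Finset.sum_congr rfl h, ← Finset.sum_div]
  gcongr
  have h2 := Nat.sum_range_choose (n + 1)
  rw [Finset.sum_range_succ] at h2
  have h3 : ∑ k ∈ range (n + 1), (n + 1).choose k ≤ 2 ^ (n + 1) := by omega
  exact_mod_cast h3

lemma aux_total (n : ℕ) (hn : 2 ≤ n) :
    ∑ k ∈ range (n + 1), (n.choose k : ℝ) * auxC n k ≤ 4 / n := by
  have hn0 : (0 : ℝ) < n := by positivity
  have h : ∀ k ∈ range (n + 1), (n.choose k : ℝ) * auxC n k =
      Real.exp (-1) / (2 * n) * (((k : ℝ) * (k - 1)) / k.factorial) +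
        1 / ((k.factorial : ℝ) * (n - k + 1).factorial) := by
    intro k hk
    have hk' : k ≤ n := by simpa [Nat.lt_succ_iff] using hk
    have h1 := Nat.choose_mul_factorial_mul_factorial hk'
    unfold auxC
    rw [← h1]
    have hc : 0 < n.choose k := Nat.choose_pos hk'
    push_cast
    field_simp
  rw [Finset.sum_congr rfl h, Finset.sum_add_distrib, ← Finset.mul_sum]
  have h1 := aux_sum1 (n - 1)
  rw [show n - 1 + 2 = n + 1 by omega] at h1
  have h2 := aux_sum2 n
  have h3 : (2 : ℝ) ^ (n + 1) / (n + 1).factorial ≤ 7 / (2 * n) := by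
    rw [div_le_div_iff₀ (by positivity) (by positivity)]
    have := aux_pow n hn
    have : (2 * n * 2 ^ (n + 1) : ℝ) ≤ 7 * (n + 1).factorial := by exact_mod_cast this
    linarith
  have h4 : Real.exp (-1) / (2 * n) * ∑ k ∈ range (n + 1), (((k : ℝ) * (k - 1)) / k.factorial) ≤
      Real.exp (-1) / (2 * n) * Real.exp 1 := mul_le_mul_of_nonneg_left h1 (by positivity)
  have h5 : Real.exp (-1) / (2 * n) * Real.exp 1 = 1 / (2 * n) := by
    rw [div_mul_eq_mul_div, ← Real.exp_add]; simp
  have h6 : 1 / (2 * (n : ℝ)) + 7 / (2 * n) = 4 / n := by field_simp; norm_num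
  linarith

lemma aux_poisson_prob (lam : ℝ) (h : 0 ≤ lam) : IsProbabilityMeasure (poissonMeasure lam) :=
  (ProbabilityTheory.hasSum_one_poissonMeasure ⟨lam, h⟩).isProbabilityMeasure_sum_dirac
    (fun _ => by positivity)

instance aux_unif_prob (n : ℕ) : IsProbabilityMeasure (uniformPerm n) := by
  constructor
  unfold uniformPerm
  rw [Measure.smul_apply, Measure.count_apply MeasurableSet.univ]
  simp only [Set.encard_univ, ENat.card_eq_coe_fintype_card, smul_eq_mul]
  exact ENNReal.inv_mul_cancel (by simp) (by simp)

/-- indicator vector -/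
def auxV (n : ℕ) (S : Finset (Fin n)) : Fin n → ℕ := fun i => if i ∈ S then 1 else 0

lemma auxV_inj (n : ℕ) : Function.Injective (auxV n) := by
  intro S T h
  ext i
  have := congrFun h i
  unfold auxV at this
  by_cases h1 : i ∈ S <;> by_cases h2 : i ∈ T <;> simp_all

lemma aux_count (n : ℕ) (S : Finset (Fin n)) :
    (Finset.univ.filter fun σ : Equiv.Perm (Fin n) => ∀ a, a ∈ S ↔ σ a = a).card =
      numDerangements (n - S.card) := by
  have h := Fintype.card_congr (derangements.subtypeEquiv (fun a : Fin n => a ∉ S))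
  rw [card_derangements_eq_numDerangements] at h
  rw [Fintype.card_subtype_compl] at h
  simp only [Fintype.card_fin, Fintype.card_coe] at h
  rw [h, Fintype.card_subtype]
  congr 1
  ext σ
  simp [Function.IsFixedPt]

lemma aux_mu (n : ℕ) (S : Finset (Fin n)) :
    ((uniformPerm n).map (fun σ => fun i => if σ i = i then (1 : ℕ) else 0)).real {auxV n S} =
      (numDerangements (n - S.card) : ℝ) / n.factorial := by
  have hm : Measurable (fun (σ : Equiv.Perm (Fin n)) => fun i => if σ i = i then (1 : ℕ) else 0) :=
    fun _ _ => trivial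
  rw [measureReal_def, Measure.map_apply hm (measurableSet_singleton _)]
  have hs : (fun (σ : Equiv.Perm (Fin n)) => fun i => if σ i = i then (1 : ℕ) else 0) ⁻¹' {auxV n S}
      = ((Finset.univ.filter fun σ : Equiv.Perm (Fin n) => ∀ a, a ∈ S ↔ σ a = a) : Finset _) := by
    ext σ
    simp only [Set.mem_preimage, Set.mem_singleton_iff, Finset.coe_filter, Finset.mem_univ,
      true_and, Set.mem_ofPred_eq, funext_iff, auxV]
    refine forall_congr' fun a => ?_
    by_cases h1 : a ∈ S <;> by_cases h2 : σ a = a <;> simp [h1, h2]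
  rw [hs]
  unfold uniformPerm
  rw [Measure.smul_apply, Measure.count_apply_finset' (MeasurableSpace.measurableSet_top), aux_count]
  simp [Fintype.card_perm, div_eq_inv_mul]

lemma aux_nu (n : ℕ) (hn : 2 ≤ n) (S : Finset (Fin n)) :
    (Measure.pi fun _ : Fin n => poissonMeasure (1 / n)).real {auxV n S} =
      Real.exp (-1) * (1 / n) ^ S.card := by
  have := aux_poisson_prob (1 / n) (by positivity)
  have hn0 : (n : ℝ) ≠ 0 := by positivity
  rw [measureReal_def, Measure.pi_singleton, ENNReal.toReal_prod]
  have : ∀ i, (poissonMeasure (1 / n) {auxV n S i}).toReal =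
      Real.exp (-(1 / n)) * (if i ∈ S then (1 / n : ℝ) else 1) := by
    intro i
    rw [poissonMeasure, Measure.sum_smul_dirac_singleton, ENNReal.toReal_ofReal (by positivity)]
    unfold auxV
    split_ifs <;> simp
  simp only [this]
  rw [Finset.prod_mul_distrib, Finset.prod_const, ← Real.exp_nat_mul, Finset.prod_ite_mem]
  simp [hn0]

lemma aux_half (n : ℕ) (hn : 2 ≤ n) (A : Set (Fin n → ℕ)) :
    ((uniformPerm n).map (fun σ => fun i => if σ i = i then (1 : ℕ) else 0)).real A ≤
      (Measure.pi fun _ : Fin n => poissonMeasure (1 / n)).real A + 4 / n := by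
  classical
  have := aux_poisson_prob (1 / n) (by positivity)
  have hm : Measurable (fun (σ : Equiv.Perm (Fin n)) => fun i => if σ i = i then (1 : ℕ) else 0) :=
    fun _ _ => trivial
  have := Measure.isProbabilityMeasure_map (μ := uniformPerm n) hm.aemeasurable
  have hA : MeasurableSet A := A.to_countable.measurableSet
  set F : Finset (Finset (Fin n)) := (Finset.univ : Finset (Fin n)).powerset.filter
    (fun S => auxV n S ∈ A) with hF
  have hsub : ((F.image (auxV n) : Finset _) : Set (Fin n → ℕ)) ⊆ A := by
    intro x hx
    simp only [Finset.coe_image, Set.mem_image, Finset.mem_coe, hF, Finset.mem_filter] at hx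
    obtain ⟨S, ⟨_, hS⟩, rfl⟩ := hx
    exact hS
  have h1 : ((uniformPerm n).map (fun σ => fun i => if σ i = i then (1 : ℕ) else 0)).real A ≤
      ((uniformPerm n).map (fun σ => fun i => if σ i = i then (1 : ℕ) else 0)).real
        ((F.image (auxV n) : Finset _) : Set (Fin n → ℕ)) := by
    rw [map_measureReal_apply hm hA, map_measureReal_apply hm (Finset.measurableSet _)]
    refine measureReal_mono ?_
    intro σ hσ
    have e : (fun i => if σ i = i then (1 : ℕ) else 0) =
        auxV n (Finset.univ.filter fun i => σ i = i) := by
      ext i; simp [auxV]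
    simp only [Set.mem_preimage] at hσ ⊢
    rw [e] at hσ ⊢
    simp only [Finset.coe_image, Set.mem_image, Finset.mem_coe, hF, Finset.mem_filter]
    exact ⟨_, ⟨by simp, hσ⟩, rfl⟩
  have h2 : (Measure.pi fun _ : Fin n => poissonMeasure (1 / n)).real
        ((F.image (auxV n) : Finset _) : Set (Fin n → ℕ)) ≤
      (Measure.pi fun _ : Fin n => poissonMeasure (1 / n)).real A := measureReal_mono hsub
  rw [← sum_measureReal_singleton, Finset.sum_image (fun _ _ _ _ h => auxV_inj n h)] at h1 h2
  simp only [aux_mu] at h1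
  simp only [aux_nu n hn] at h2
  have h3 : ∑ S ∈ F, (numDerangements (n - S.card) : ℝ) / n.factorial ≤
      ∑ S ∈ F, (Real.exp (-1) * (1 / n) ^ S.card + auxC n S.card) :=
    Finset.sum_le_sum fun S _ => aux_point n hn _ (by simpa using S.card_le_univ)
  rw [Finset.sum_add_distrib] at h3
  have h4 : ∑ S ∈ F, auxC n S.card ≤
      ∑ S ∈ (Finset.univ : Finset (Fin n)).powerset, auxC n S.card :=
    Finset.sum_le_sum_of_subset_of_nonneg (Finset.filter_subset _ _)
      (fun _ _ _ => auxC_nonneg _ _)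
  rw [Finset.sum_powerset_apply_card] at h4
  simp only [Finset.card_univ, Fintype.card_fin, nsmul_eq_mul] at h4
  have h5 := aux_total n hn
  linarith

/-- Poisson process approximation for the matching problem: for a uniformly random
permutation `σ` of `{1, …, n}` (`n ≥ 2`), let `X_i` indicate `σ(i) = i`, and let
`Y_1, …, Y_n` be independent Poisson variables of mean `1/n`.  Then the total variation
distance between `L(X_1, …, X_n)` and `L(Y_1, …, Y_n)` on `ℕ^n` is at most `4/n`. -/
theorem matching_process_poisson_approx (n : ℕ) (hn : 2 ≤ n) :
    ∀ A : Set (Fin n → ℕ),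
      |(((uniformPerm n).map (fun σ => fun i => if σ i = i then (1 : ℕ) else 0)) A).toReal -
        ((Measure.pi fun _ : Fin n => poissonMeasure (1 / n)) A).toReal| ≤ 4 / n := by
  intro A
  have := aux_poisson_prob (1 / n) (by positivity)
  have hm : Measurable (fun (σ : Equiv.Perm (Fin n)) => fun i => if σ i = i then (1 : ℕ) else 0) :=
    fun _ _ => trivial
  have := Measure.isProbabilityMeasure_map (μ := uniformPerm n) hm.aemeasurable
  have hA : MeasurableSet A := A.to_countable.measurableSet
  have h1 := aux_half n hn A
  have h2 := aux_half n hn Aᶜ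
  rw [probReal_compl_eq_one_sub hA, probReal_compl_eq_one_sub hA] at h2
  rw [← measureReal_def, ← measureReal_def, abs_le]
  constructor <;> linarith
end

section
/- Let J be a finite nonempty set, let {X_i}_{i ∈ J} be {0,1}-valued random variables with λ = Σ_{i ∈ J} E(X_i) > 0, let W = Σ_{i ∈ J} X_i, and let I be uniformly distributed on J and independent of the family {X_i}. Then for every bounded f : ℕ → ℝ, E(W f(W)) = λ · E(f(W) | X_I = 1). -/
open MeasureTheory ProbabilityTheory

/-- Size-bias identity: if `{X_i}_{i ∈ J}` are `{0,1}`-valued with `λ = Σ E(X_i) > 0`,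
`W = Σ X_i`, and `I` is uniform on `J` and independent of the family `{X_i}`, then for
every bounded `f : ℕ → ℝ`, `E(W f(W)) = λ E(f(W) | X_I = 1)`. -/
theorem size_bias_identity
    {Ω : Type*} [MeasurableSpace Ω] (P : Measure Ω) [IsProbabilityMeasure P]
    {J : Type*} [Fintype J] [Nonempty J] [MeasurableSpace J] [MeasurableSingletonClass J]
    (X : J → Ω → ℕ) (hXm : ∀ i, Measurable (X i))
    (hval : ∀ i ω, X i ω = 0 ∨ X i ω = 1)
    (lam : ℝ) (hlam : lam = ∑ i, ∫ ω, (X i ω : ℝ) ∂P) (hlampos : 0 < lam)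
    (W : Ω → ℕ) (hW : ∀ ω, W ω = ∑ i, X i ω)
    (I : Ω → J) (hIm : Measurable I)
    (hIunif : ∀ j, P {ω | I ω = j} = (Fintype.card J : ENNReal)⁻¹)
    (hindep : IndepFun I (fun ω => fun i => X i ω) P)
    (f : ℕ → ℝ) (hf : ∃ C : ℝ, ∀ k, |f k| ≤ C) :
    ∫ ω, (W ω : ℝ) * f (W ω) ∂P =
      lam * ∫ ω, f (W ω) ∂(P[|{ω | X (I ω) ω = 1}]) := by
  classical
  obtain ⟨C, hC⟩ := hf
  have hWm : Measurable W := by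
    have : W = fun ω => ∑ i, X i ω := funext hW
    rw [this]
    exact Finset.measurable_sum _ (fun i _ => hXm i)
  have hX1 : ∀ i ω, |(X i ω : ℝ)| ≤ 1 := by
    intro i ω
    rcases hval i ω with h | h <;> simp [h]
  set A : Set Ω := {ω | X (I ω) ω = 1} with hA
  have hAm : MeasurableSet A := by
    have : A = ⋃ j, ({ω | I ω = j} ∩ {ω | X j ω = 1}) := by
      ext ω; simp [hA]
    rw [this]
    exact MeasurableSet.iUnion fun j =>
      (hIm (measurableSet_singleton j)).inter (hXm j (measurableSet_singleton 1))
  have hint : ∀ (g : ℕ → ℝ) (C : ℝ), (∀ k, |g k| ≤ C) → ∀ j,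
      Integrable (fun ω => (X j ω : ℝ) * g (W ω)) P := by
    intro g C hg j
    refine Integrable.of_bound (C := 1 * C) (Measurable.aestronglyMeasurable ?_) ?_
    · exact ((measurable_from_top (f := fun n : ℕ => (n : ℝ))).comp (hXm j)).mul
        ((measurable_from_top (f := g)).comp hWm)
    · refine Filter.Eventually.of_forall fun ω => ?_
      rw [Real.norm_eq_abs, abs_mul]
      exact mul_le_mul (hX1 j ω) (hg _) (abs_nonneg _) zero_le_one
  have hsum : ∀ (g : ℕ → ℝ) (C : ℝ), (∀ k, |g k| ≤ C) →
      ∫ ω, (W ω : ℝ) * g (W ω) ∂P = ∑ j, ∫ ω, (X j ω : ℝ) * g (W ω) ∂P := by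
    intro g C hg
    rw [← integral_finsetSum _ (fun j _ => hint g C hg j)]
    congr 1
    ext ω
    rw [← Finset.sum_mul]
    congr 1
    rw [hW ω]
    push_cast
    rfl
  have key : ∀ (g : ℕ → ℝ) (C : ℝ), (∀ k, |g k| ≤ C) →
      ∫ ω in A, g (W ω) ∂P
        = (Fintype.card J : ℝ)⁻¹ * ∫ ω, (W ω : ℝ) * g (W ω) ∂P := by
    intro g C hg
    have hind : ∀ j, Measurable (fun ω => if I ω = j then (1 : ℝ) else 0) := fun j =>
      (measurable_of_finite (fun i : J => if i = j then (1 : ℝ) else 0)).comp hIm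
    have hpt : (fun ω => A.indicator (fun ω => g (W ω)) ω) = fun ω =>
        ∑ j, (if I ω = j then (1 : ℝ) else 0) * ((X j ω : ℝ) * g (W ω)) := by
      ext ω
      simp only [ite_mul, one_mul, zero_mul, Finset.sum_ite_eq, Finset.mem_univ, if_true]
      rcases hval (I ω) ω with h | h <;> simp [hA, Set.indicator, h]
    rw [← integral_indicator hAm, hpt, integral_finsetSum, hsum g C hg, Finset.mul_sum]
    · refine Finset.sum_congr rfl fun j _ => ?_
      have h1 : IndepFun (fun ω => if I ω = j then (1 : ℝ) else 0)
          (fun ω => (X j ω : ℝ) * g (W ω)) P := by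
        have := hindep.comp
          (measurable_of_finite (fun i : J => if i = j then (1 : ℝ) else 0))
          (ψ := fun x : J → ℕ => (x j : ℝ) * g (∑ i, x i)) (by
            refine Measurable.mul ?_ ?_
            · exact (measurable_from_top (f := fun n : ℕ => (n : ℝ))).comp
                (measurable_pi_apply j)
            · exact (measurable_from_top (f := g)).comp
                (Finset.measurable_sum _ (fun i _ => measurable_pi_apply i)))
        have hWe : W = fun ω => ∑ i, X i ω := funext hW
        rw [hWe]
        exact this
      rw [h1.integral_fun_mul_eq_mul_integral (hind j).aestronglyMeasurable
        (hint g C hg j).aestronglyMeasurable]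
      congr 1
      have : (fun ω => if I ω = j then (1 : ℝ) else 0)
          = {ω | I ω = j}.indicator 1 := by
        ext ω; simp [Set.indicator]
      have hm : MeasurableSet {ω | I ω = j} := hIm (measurableSet_singleton j)
      rw [this]
      refine (integral_indicator_one hm).trans ?_
      rw [measureReal_def, hIunif j]
      simp
    · intro j _
      refine (hint g C hg j).bdd_mul (c := 1) (hind j).aestronglyMeasurable
        (Filter.Eventually.of_forall fun ω => ?_)
      split_ifs <;> simp
  have hcard : (Fintype.card J : ℝ) ≠ 0 := by
    exact_mod_cast Fintype.card_ne_zero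
  have hPA : P.real A = (Fintype.card J : ℝ)⁻¹ * lam := by
    have h := key (fun _ => 1) 1 (by simp)
    rw [hsum (fun _ => 1) 1 (by simp)] at h
    simpa [← hlam] using h
  have hne : lam ≠ 0 := hlampos.ne'
  rw [ProbabilityTheory.cond, integral_smul_measure, key f C hC, ENNReal.toReal_inv,
    ← measureReal_def, hPA, smul_eq_mul]
  field_simp
end

section
/- Let J be a finite set and let {X_i}_{i ∈ J} be {0,1}-valued random variables that are negatively associated: for all disjoint subsets A, B ⊆ J and all functions f : {0,1}^A → ℝ and g : {0,1}^B → ℝ that are monotone nondecreasing with respect to the coordinatewise partial order, E[f((X_i)_{i ∈ A}) · g((X_j)_{j ∈ B})] ≤ E[f((X_i)_{i ∈ A})] · E[g((X_j)_{j ∈ B})]. Let W = Σ_{i ∈ J} X_i, λ = E(W) > 0, and σ² = Var(W). Then ‖L(W) - Poi_λ‖_TV ≤ (1 - e^{-λ}) · (1 - σ²/λ). -/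
open MeasureTheory

noncomputable def ppm (l : ℝ) (k : ℕ) : ℝ := Real.exp (-l) * l ^ k / (Nat.factorial k)

lemma ppm_pos {l : ℝ} (hl : 0 < l) (k : ℕ) : 0 < ppm l k := by
  unfold ppm; positivity

lemma ppm_succ (l : ℝ) (k : ℕ) : ppm l (k+1) * (k+1) = l * ppm l k := by
  unfold ppm
  rw [Nat.factorial_succ]
  push_cast
  have : (Nat.factorial k : ℝ) ≠ 0 := by positivity
  have : (k : ℝ) + 1 ≠ 0 := by positivity
  field_simp
  ring

lemma ppm_zero (l : ℝ) : ppm l 0 = Real.exp (-l) := by simp [ppm]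

lemma ppm_hasSum (l : ℝ) : HasSum (ppm l) 1 := by
  have h := (NormedSpace.expSeries_div_hasSum_exp l).mul_left (Real.exp (-l))
  rw [← Real.exp_eq_exp_ℝ, ← Real.exp_add] at h
  simp only [neg_add_cancel, Real.exp_zero] at h
  have e : ppm l = fun i => Real.exp (-l) * (l ^ i / (Nat.factorial i)) := by
    funext k
    unfold ppm; ring
  rw [e]
  exact h

/-- shifted Stein solution -/
noncomputable def gg (l : ℝ) (a : ℕ → ℝ) (k : ℕ) : ℝ :=
  (∑ j ∈ Finset.range (k+1), a j * ppm l j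
    - (∑' j, a j * ppm l j) * ∑ j ∈ Finset.range (k+1), ppm l j) / (l * ppm l k)

lemma gg_zero {l : ℝ} (hl : 0 < l) (a : ℕ → ℝ) :
    l * gg l a 0 = a 0 - ∑' j, a j * ppm l j := by
  have := ppm_pos hl 0
  unfold gg
  simp only [zero_add, Finset.sum_range_one]
  field_simp

lemma gg_succ {l : ℝ} (hl : 0 < l) (a : ℕ → ℝ) (k : ℕ) :
    l * gg l a (k+1) - (k+1) * gg l a k = a (k+1) - ∑' j, a j * ppm l j := by
  have h1 := ppm_pos hl k
  have h2 := ppm_succ l k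
  have h3 : ppm l (k+1) = l * ppm l k / (k+1) := by
    rw [← h2]; field_simp
  unfold gg
  rw [Finset.sum_range_succ _ (k+1), Finset.sum_range_succ _ (k+1), h3]
  field_simp
  ring

lemma gg_diff {l : ℝ} (hl : 0 < l) (a : ℕ → ℝ) (ha0 : ∀ k, 0 ≤ a k) (ha1 : ∀ k, a k ≤ 1) (k : ℕ) :
    gg l a (k+1) - gg l a k ≤ (1 - Real.exp (-l)) / l := by
  have hs := (ppm_hasSum l).summable
  have hsa : Summable (fun j => a j * ppm l j) :=
    Summable.of_nonneg_of_le (fun j => mul_nonneg (ha0 j) (ppm_pos hl j).le)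
      (fun j => mul_le_of_le_one_left (ppm_pos hl j).le (ha1 j)) hs
  have e1 := hs.sum_add_tsum_nat_add (k+2)
  have e2 := hsa.sum_add_tsum_nat_add (k+2)
  have e3 := hs.sum_add_tsum_nat_add (k+1)
  rw [(ppm_hasSum l).tsum_eq] at e1 e3
  have hq := ppm_pos hl k
  have hp := ppm_pos hl (k+1)
  have hqp := ppm_succ l k
  have hH : ∑' j, ppm l (j + (k+2)) ≤ l / (k+1) * ∑' j, ppm l (j + (k+1)) := by
    rw [← tsum_mul_left]
    refine Summable.tsum_le_tsum (fun j => ?_) ((summable_nat_add_iff _).2 hs)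
      (((summable_nat_add_iff _).2 hs).mul_left _)
    have h := ppm_succ l (j + (k+1))
    have h' := ppm_pos hl (j + (k+2))
    rw [show j + (k+1) + 1 = j + (k+2) by ring] at h
    rw [div_mul_eq_mul_div, le_div_iff₀ (by positivity), ← h]
    push_cast
    have : (0:ℝ) ≤ j := by positivity
    nlinarith
  have hG : l / (k+1) * ∑ j ∈ Finset.range (k+1), ppm l j
      ≤ ∑ j ∈ Finset.range (k+1), ppm l (j+1) := by
    rw [Finset.mul_sum]
    refine Finset.sum_le_sum (fun j hj => ?_)
    have hj' : (j:ℝ) ≤ k := by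
      have := Finset.mem_range.1 hj
      exact_mod_cast Nat.lt_succ_iff.1 this
    have h := ppm_succ l j
    have h' := ppm_pos hl (j+1)
    rw [div_mul_eq_mul_div, div_le_iff₀ (by positivity), ← h]
    nlinarith
  have e4 := Finset.sum_range_succ' (ppm l) (k+1)
  rw [ppm_zero, Finset.sum_range_succ] at e4
  have hT0 : 0 ≤ ∑' j, a (j + (k+2)) * ppm l (j + (k+2)) :=
    tsum_nonneg fun j => mul_nonneg (ha0 _) (ppm_pos hl _).le
  have hB0 : 0 ≤ ∑ j ∈ Finset.range (k+1), a j * ppm l j :=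
    Finset.sum_nonneg fun j _ => mul_nonneg (ha0 _) (ppm_pos hl _).le
  have hH0 : 0 ≤ ∑' j, ppm l (j + (k+2)) := tsum_nonneg fun j => (ppm_pos hl _).le
  have hG0 : 0 ≤ ∑ j ∈ Finset.range (k+1), ppm l j :=
    Finset.sum_nonneg fun j _ => (ppm_pos hl _).le
  unfold gg
  rw [Finset.sum_range_succ _ (k+1)] at e1 e2
  rw [Finset.sum_range_succ _ (k+1), Finset.sum_range_succ _ (k+1), ← e2]
  set B := ∑ j ∈ Finset.range (k+1), a j * ppm l j
  set T := ∑' j, a (j + (k+2)) * ppm l (j + (k+2))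
  set H := ∑' j, ppm l (j + (k+2))
  set G := ∑ j ∈ Finset.range (k+1), ppm l j
  set H' := ∑' j, ppm l (j + (k+1))
  set G' := ∑ j ∈ Finset.range (k+1), ppm l (j+1)
  set p := ppm l (k+1)
  set q := ppm l k
  have hb0 := ha0 (k+1)
  have hb1 := ha1 (k+1)
  set b := a (k+1)
  have hr : l / (k+1) = p / q := by
    rw [div_eq_div_iff (by positivity) (by positivity), hqp]
  rw [hr] at hH hG
  have hexp := Real.exp_pos (-l)
  set x := Real.exp (-l)
  clear_value B T H G H' G' p q b x
  have hH' : H' = p + H := by linarith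
  have hG' : G' = G + p - x := by linarith
  subst hH' hG'
  have key : (B + b * p - (B + b * p + T) * (G + p)) / (l * p) - (B - (B + b * p + T) * G) / (l * q)
      = (B * (H - p / q * (p + H)) / p + b * (H + p / q * G) - T * (G + p - p / q * G) / p) / l := by
    have : H = 1 - G - p := by linarith
    subst this
    field_simp
    ring
  rw [key]
  apply div_le_div_of_nonneg_right _ hl.le
  have t1 : B * (H - p / q * (p + H)) / p ≤ 0 :=
    div_nonpos_of_nonpos_of_nonneg (mul_nonpos_of_nonneg_of_nonpos hB0 (by linarith)) hp.le
  have t2 : 0 ≤ T * (G + p - p / q * G) / p := by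
    apply div_nonneg (mul_nonneg hT0 (by linarith)) hp.le
  have t0 : 0 ≤ p / q * G := by positivity
  have t3 : b * (H + p / q * G) ≤ 1 * (H + p / q * G) :=
    mul_le_mul_of_nonneg_right hb1 (by linarith)
  linarith

lemma poi_real {l : ℝ} (hl : 0 < l) (A : Set ℕ) :
    (poissonMeasure l A).toReal = ∑' j, A.indicator (fun _ => (1:ℝ)) j * ppm l j := by
  unfold poissonMeasure
  rw [Measure.sum_apply _ (MeasurableSet.of_discrete), ENNReal.tsum_toReal_eq]
  · refine tsum_congr fun j => ?_
    rw [Measure.smul_apply, Measure.dirac_apply, smul_eq_mul, ENNReal.toReal_mul,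
      ENNReal.toReal_ofReal (show 0 ≤ Real.exp (-l) * l ^ j / (Nat.factorial j) from (ppm_pos hl j).le)]
    by_cases h : j ∈ A <;> simp [h, ppm]
  · intro j
    rw [Measure.smul_apply, Measure.dirac_apply, smul_eq_mul]
    by_cases h : j ∈ A <;> simp [h]

lemma bdd_integrable {Ω : Type*} [MeasurableSpace Ω] (P : Measure Ω) [IsProbabilityMeasure P]
    {J : Type*} [Fintype J]
    (X : J → Ω → ℕ) (hXm : ∀ i, Measurable (X i))
    (hval : ∀ i ω, X i ω = 0 ∨ X i ω = 1) (φ : (J → ℕ) → ℝ) :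
    Integrable (fun ω => φ (fun i => X i ω)) P := by
  have hfin : (Set.pi Set.univ (fun _ : J => ({0,1} : Set ℕ))).Finite :=
    Set.Finite.pi fun _ => Set.toFinite _
  obtain ⟨C, hC⟩ := (hfin.image (fun x => ‖φ x‖)).bddAbove
  refine Integrable.of_bound (C := C) ?_ (Filter.Eventually.of_forall fun ω => ?_)
  · exact ((measurable_of_countable φ).comp (measurable_pi_lambda _ hXm)).aestronglyMeasurable
  · apply hC
    refine ⟨_, ?_, rfl⟩
    intro i _
    simpa using hval i ω

lemma one_side
    {Ω : Type*} [MeasurableSpace Ω] (P : Measure Ω) [IsProbabilityMeasure P]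
    {J : Type*} [Fintype J]
    (X : J → Ω → ℕ) (hXm : ∀ i, Measurable (X i))
    (hval : ∀ i ω, X i ω = 0 ∨ X i ω = 1)
    (hNA : ∀ A B : Finset J, Disjoint A B →
      ∀ f g : (J → ℕ) → ℝ, Monotone f → Monotone g →
      (∀ x y : J → ℕ, (∀ i ∈ A, x i = y i) → f x = f y) →
      (∀ x y : J → ℕ, (∀ j ∈ B, x j = y j) → g x = g y) →
      ∫ ω, f (fun i => X i ω) * g (fun i => X i ω) ∂P ≤
        (∫ ω, f (fun i => X i ω) ∂P) * ∫ ω, g (fun i => X i ω) ∂P)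
    (W : Ω → ℕ) (hW : ∀ ω, W ω = ∑ i, X i ω)
    (lam : ℝ) (hlam : lam = ∫ ω, (W ω : ℝ) ∂P) (hlampos : 0 < lam)
    (σ2 : ℝ) (hσ2 : σ2 = ∫ ω, ((W ω : ℝ) - lam) ^ 2 ∂P) (A : Set ℕ) :
      ((P.map W) A).toReal - (poissonMeasure lam A).toReal ≤
        (1 - Real.exp (-lam)) * (1 - σ2 / lam) := by
  classical
  have hint := bdd_integrable P X hXm hval
  obtain rfl : W = fun ω => ∑ i, X i ω := funext hW
  have hWm : Measurable (fun ω => ∑ i, X i ω) := Finset.measurable_sum _ fun i _ => hXm i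
  set a : ℕ → ℝ := A.indicator (fun _ => (1:ℝ)) with ha
  have ha0 : ∀ k, 0 ≤ a k := fun k => Set.indicator_nonneg (fun _ _ => zero_le_one) k
  have ha1 : ∀ k, a k ≤ 1 := fun k => Set.indicator_le_self' (fun _ _ => zero_le_one) k
  have hmap : ((P.map (fun ω => ∑ i, X i ω)) A).toReal = ∫ ω, a (∑ i, X i ω) ∂P := by
    rw [← integral_map (φ := fun ω => ∑ i, X i ω) (f := a) hWm.aemeasurable
      (measurable_of_countable a).aestronglyMeasurable, ha,
      integral_indicator MeasurableSet.of_discrete]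
    simp [Measure.real]
  set c := (1 - Real.exp (-lam)) / lam with hc
  set g := gg lam a with hg
  have hgd : ∀ k, g (k+1) ≤ g k + c := fun k => by
    have := gg_diff hlampos a ha0 ha1 k
    linarith
  rw [poi_real hlampos, hmap]
  -- Stein identity
  have hst : ∀ ω, a (∑ i, X i ω) - ∑' j, a j * ppm lam j
      = lam * g (∑ i, X i ω) - ∑ i, (X i ω : ℝ) * g (∑ j ∈ Finset.univ.erase i, X j ω) := by
    intro ω
    have h1 : ∑ i, (X i ω : ℝ) * g (∑ j ∈ Finset.univ.erase i, X j ω)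
        = ((∑ i, X i ω : ℕ) : ℝ) * g ((∑ i, X i ω) - 1) := by
      rw [Nat.cast_sum, Finset.sum_mul]
      refine Finset.sum_congr rfl fun i _ => ?_
      rcases hval i ω with h | h
      · simp [h]
      · congr 2
        rw [← Finset.add_sum_erase _ _ (Finset.mem_univ i), h]
        simp
    rw [h1]
    generalize (∑ i, X i ω) = n
    cases n with
    | zero => simp [hg, gg_zero hlampos]
    | succ k =>
      have := gg_succ hlampos a k
      simp only [Nat.add_sub_cancel]
      push_cast
      linarith
  set p : J → ℝ := fun i => ∫ ω, (X i ω : ℝ) ∂P with hp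
  have hp0 : ∀ i, 0 ≤ p i := fun i => integral_nonneg fun ω => by positivity
  have hlp : lam = ∑ i, p i := by
    rw [hlam, hp, ← integral_finsetSum]
    · simp
    · intro i _; exact hint (fun x => (x i : ℝ))
  have hsum : ∀ (x : J → ℕ) i, ∑ j, x j = x i + ∑ j ∈ Finset.univ.erase i, x j := fun x i =>
    (Finset.add_sum_erase _ _ (Finset.mem_univ i)).symm
  -- key bound
  have hkey : ∀ i, p i * (∫ ω, g (∑ j, X j ω) ∂P)
      - ∫ ω, (X i ω : ℝ) * g (∑ j ∈ Finset.univ.erase i, X j ω) ∂P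
      ≤ c * (p i * lam - (∫ ω, (X i ω : ℝ) * ((∑ j, X j ω : ℕ) : ℝ) ∂P) + p i) := by
    intro i
    have hna := hNA {i} (Finset.univ.erase i) (by simp)
      (fun x => (x i : ℝ))
      (fun x => c * ((∑ j ∈ Finset.univ.erase i, x j : ℕ) : ℝ) - g (∑ j ∈ Finset.univ.erase i, x j))
      (fun x y h => Nat.cast_le.2 (h i))
      (by
        have hm : Monotone (fun n : ℕ => c * (n:ℝ) - g n) := by
          apply monotone_nat_of_le_succ
          intro n
          have := hgd n
          push_cast
          linarith
        intro x y h
        exact hm (Finset.sum_le_sum fun j _ => h j))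
      (fun x y h => by simp [h i (by simp)])
      (fun x y h => by
        have : ∑ j ∈ Finset.univ.erase i, x j = ∑ j ∈ Finset.univ.erase i, y j :=
          Finset.sum_congr rfl h
        simp only [this])
    have i1 := hint (fun x => g (∑ j ∈ Finset.univ.erase i, x j))
    have i2 := hint (fun x => ((∑ j ∈ Finset.univ.erase i, x j : ℕ) : ℝ))
    have i3 := hint (fun x => (x i : ℝ) * g (∑ j ∈ Finset.univ.erase i, x j))
    have i4 := hint (fun x => (x i : ℝ) * ((∑ j ∈ Finset.univ.erase i, x j : ℕ) : ℝ))
    have i5 := hint (fun x => (x i : ℝ))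
    have i6 := hint (fun x => g (∑ j, x j))
    have s1 : ∫ ω, g (∑ j, X j ω) ∂P ≤ (∫ ω, g (∑ j ∈ Finset.univ.erase i, X j ω) ∂P) + c * p i := by
      rw [hp, ← integral_const_mul, ← integral_add i1 (i5.const_mul c)]
      refine integral_mono i6 (i1.add (i5.const_mul c)) fun ω => ?_
      simp only
      rw [hsum (fun j => X j ω) i]
      rcases hval i ω with h | h
      · simp [h]
      · have := hgd (∑ j ∈ Finset.univ.erase i, X j ω)
        simp only [h]
        rw [add_comm 1]
        simpa using this
    have s2 : ∫ ω, (X i ω : ℝ) * (c * ((∑ j ∈ Finset.univ.erase i, X j ω : ℕ) : ℝ)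
        - g (∑ j ∈ Finset.univ.erase i, X j ω)) ∂P
        = c * (∫ ω, (X i ω : ℝ) * ((∑ j ∈ Finset.univ.erase i, X j ω : ℕ) : ℝ) ∂P)
          - ∫ ω, (X i ω : ℝ) * g (∑ j ∈ Finset.univ.erase i, X j ω) ∂P := by
      rw [← integral_const_mul, ← integral_sub (i4.const_mul c) i3]
      congr 1
      funext ω
      ring
    have s3 : ∫ ω, (c * ((∑ j ∈ Finset.univ.erase i, X j ω : ℕ) : ℝ)
        - g (∑ j ∈ Finset.univ.erase i, X j ω)) ∂P
        = c * (∫ ω, ((∑ j ∈ Finset.univ.erase i, X j ω : ℕ) : ℝ) ∂P)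
          - ∫ ω, g (∑ j ∈ Finset.univ.erase i, X j ω) ∂P := by
      rw [← integral_const_mul, ← integral_sub (i2.const_mul c) i1]
    have s4 : lam = p i + ∫ ω, ((∑ j ∈ Finset.univ.erase i, X j ω : ℕ) : ℝ) ∂P := by
      rw [hlam, hp, ← integral_add i5 i2]
      congr 1
      funext ω
      simp only
      rw [hsum (fun j => X j ω) i]
      push_cast
      rfl
    have s5 : ∫ ω, (X i ω : ℝ) * ((∑ j, X j ω : ℕ) : ℝ) ∂P
        = p i + ∫ ω, (X i ω : ℝ) * ((∑ j ∈ Finset.univ.erase i, X j ω : ℕ) : ℝ) ∂P := by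
      rw [hp, ← integral_add i5 i4]
      congr 1
      funext ω
      rw [hsum (fun j => X j ω) i]
      rcases hval i ω with h | h <;> simp [h]
    rw [s2, s3] at hna
    rw [s5]
    have s6 := mul_le_mul_of_nonneg_left s1 (hp0 i)
    change _ ≤ p i * _ at hna
    generalize (∫ ω, ((∑ j ∈ Finset.univ.erase i, X j ω : ℕ) : ℝ) ∂P) = m at *
    rw [s4]
    nlinarith
  have hE : (∫ ω, a (∑ i, X i ω) ∂P) - ∑' j, a j * ppm lam j
      = ∑ i, (p i * (∫ ω, g (∑ j, X j ω) ∂P)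
      - ∫ ω, (X i ω : ℝ) * g (∑ j ∈ Finset.univ.erase i, X j ω) ∂P) := by
    have j1 := hint (fun x => a (∑ j, x j))
    have j2 := hint (fun x => g (∑ j, x j))
    have j3 := fun i => hint (fun x => (x i : ℝ) * g (∑ j ∈ Finset.univ.erase i, x j))
    rw [Finset.sum_sub_distrib, ← Finset.sum_mul, ← hlp, ← integral_finsetSum _ (fun i _ => j3 i),
      ← integral_const_mul, ← integral_sub (j2.const_mul _) (integrable_finsetSum _ fun i _ => j3 i)]
    simp_rw [← hst]
    rw [integral_sub j1 (integrable_const _)]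
    simp
  have hV : ∑ i, ∫ ω, (X i ω : ℝ) * ((∑ j, X j ω : ℕ) : ℝ) ∂P = σ2 + lam ^ 2 := by
    have j1 := hint (fun x => ((∑ j, x j : ℕ) : ℝ))
    have j2 := hint (fun x => ((∑ j, x j : ℕ) : ℝ)^2)
    rw [← integral_finsetSum _ (fun i _ => hint (fun x => (x i : ℝ) * ((∑ j, x j : ℕ) : ℝ)))]
    have e1 : σ2 = (∫ ω, ((∑ j, X j ω : ℕ) : ℝ)^2 ∂P) - 2 * lam * (∫ ω, ((∑ j, X j ω : ℕ) : ℝ) ∂P)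
        + lam ^ 2 := by
      rw [hσ2, ← integral_const_mul]
      have h2 : (lam^2 : ℝ) = ∫ ω, lam^2 ∂P := by simp
      have h3 : Integrable (fun ω => ((∑ j, X j ω : ℕ) : ℝ)^2 - 2 * lam * ((∑ j, X j ω : ℕ) : ℝ)) P :=
        j2.sub (j1.const_mul _)
      rw [← integral_sub j2 (j1.const_mul _), h2, ← integral_add h3 (integrable_const _)]
      congr 1
      funext ω
      ring
    rw [← hlam] at e1
    have e2 : ∀ ω, ∑ i, (X i ω : ℝ) * ((∑ j, X j ω : ℕ) : ℝ) = ((∑ j, X j ω : ℕ) : ℝ)^2 := by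
      intro ω
      rw [← Finset.sum_mul, ← Nat.cast_sum, sq]
    simp_rw [e2]
    linarith
  rw [hE]
  refine (Finset.sum_le_sum fun i _ => hkey i).trans (le_of_eq ?_)
  rw [← Finset.mul_sum, Finset.sum_add_distrib, Finset.sum_sub_distrib, ← Finset.sum_mul, ← hlp, hV, hc]
  field_simp
  ring

/-- Poisson approximation for sums of negatively associated indicators: if the
`{0,1}`-valued `{X_i}_{i ∈ J}` are negatively associated, `W = Σ X_i`, `λ = E(W) > 0`
and `σ² = Var(W)`, then `‖L(W) - Poi_λ‖_TV ≤ (1 - e^{-λ})(1 - σ²/λ)`. -/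
theorem negatively_associated_poisson_approx
    {Ω : Type*} [MeasurableSpace Ω] (P : Measure Ω) [IsProbabilityMeasure P]
    {J : Type*} [Fintype J]
    (X : J → Ω → ℕ) (hXm : ∀ i, Measurable (X i))
    (hval : ∀ i ω, X i ω = 0 ∨ X i ω = 1)
    (hNA : ∀ A B : Finset J, Disjoint A B →
      ∀ f g : (J → ℕ) → ℝ, Monotone f → Monotone g →
      (∀ x y : J → ℕ, (∀ i ∈ A, x i = y i) → f x = f y) →
      (∀ x y : J → ℕ, (∀ j ∈ B, x j = y j) → g x = g y) →
      ∫ ω, f (fun i => X i ω) * g (fun i => X i ω) ∂P ≤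
        (∫ ω, f (fun i => X i ω) ∂P) * ∫ ω, g (fun i => X i ω) ∂P)
    (W : Ω → ℕ) (hW : ∀ ω, W ω = ∑ i, X i ω)
    (lam : ℝ) (hlam : lam = ∫ ω, (W ω : ℝ) ∂P) (hlampos : 0 < lam)
    (σ2 : ℝ) (hσ2 : σ2 = ∫ ω, ((W ω : ℝ) - lam) ^ 2 ∂P) :
    ∀ A : Set ℕ,
      |((P.map W) A).toReal - (poissonMeasure lam A).toReal| ≤
        (1 - Real.exp (-lam)) * (1 - σ2 / lam) := by
  classical
  intro A
  have h1 := one_side P X hXm hval hNA W hW lam hlam hlampos σ2 hσ2 A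
  have h2 := one_side P X hXm hval hNA W hW lam hlam hlampos σ2 hσ2 Aᶜ
  have hWm : Measurable W := by
    obtain rfl : W = fun ω => ∑ i, X i ω := funext hW
    exact Finset.measurable_sum _ fun i _ => hXm i
  have : IsProbabilityMeasure (P.map W) := Measure.isProbabilityMeasure_map hWm.aemeasurable
  have hpu : poissonMeasure lam Set.univ = 1 := by
    have h := poi_real hlampos Set.univ
    simp only [Set.indicator_univ, one_mul, (ppm_hasSum lam).tsum_eq] at h
    exact (ENNReal.toReal_eq_one_iff _).1 h
  have : IsProbabilityMeasure (poissonMeasure lam) := ⟨hpu⟩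
  have e1 := probReal_compl_eq_one_sub (μ := P.map W) (s := A) MeasurableSet.of_discrete
  have e2 := probReal_compl_eq_one_sub (μ := poissonMeasure lam) (s := A) MeasurableSet.of_discrete
  simp only [Measure.real] at e1 e2
  rw [e1, e2] at h2
  rw [abs_le]
  constructor <;> linarith
end
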